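/- Let s, t, u, λ, x₁, x₂ ∈ ℂ with Re(2λ − s + t + u) > 0. For each integer k ≥ 0 write ε_k = (λ−x₁)(λ−x₂)/(λ+k), and let c_k^+, c_k^− ∈ ℂ be any numbers satisfying c_k^+ + c_k^− = s + k and c_k^+ c_k^− = x₁x₂ + (s + k − x₁ − x₂)λ. Assume: x₁, x₂, λ are not nonpositive integers; s − x₁ − x₂ + k ≠ 0 for all integers k ≥ 0; λ − ε_k, s − λ + ε_k + k, c_k^+ and c_k^− are not nonpositive integers for all k ≥ 0; and s − x₁ − x₂, t − x₁, t − x₂, u + x₁ + x₂ are not nonpositive integers. Then both of the following series converge and Γ(x₁)Γ(x₂)Γ(s−x₁−x₂) / ( Γ(t−x₁)Γ(t−x₂)Γ(u+x₁+x₂) ) = ∑_{k=0}^{∞} [ (−1)^k / k! ] · [ Γ(λ−ε_k) Γ(s−λ+ε_k+k) / ( Γ(t+k) Γ(t−λ+ε_k) Γ(u+λ−ε_k−k) ) ] · ( 1/(x₁+k) + 1/(x₂+k) − 1/(λ+k) ) + ∑_{k=0}^{∞} [ (−1)^k / k! ] · [ Γ(c_k^+) Γ(c_k^−) / ( Γ(t−c_k^+)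 Γ(t−c_k^−) Γ(u+s+k) ) ] · 1/(s+k−x₁−x₂). -/

import Mathlib

open Finset Filter Topology Complex

lemma pf_aux {ι : Type*} [DecidableEq ι] (S : Finset ι) (a b d e v : ι → ℂ) (x : ℂ)
    (hd : ∀ i ∈ S, d i ≠ 0) (hv : ∀ i ∈ S, d i * v i + e i = 0)
    (hinj : Set.InjOn v S) (hx : ∀ i ∈ S, d i * x + e i ≠ 0) :
    (∏ i ∈ S, (a i * x + b i)) / (∏ i ∈ S, (d i * x + e i))
      = (∏ i ∈ S, a i) / (∏ i ∈ S, d i)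
        + ∑ i ∈ S, (∏ j ∈ S, (a j * v i + b j))
            / (∏ j ∈ S.erase i, (d j * v i + e j)) / (d i * x + e i) := by
  classical
  set A : Polynomial ℂ := ∏ i ∈ S, (Polynomial.C (a i) * Polynomial.X + Polynomial.C (b i)) with hA
  set D : Polynomial ℂ := ∏ i ∈ S, (Polynomial.C (d i) * Polynomial.X + Polynomial.C (e i)) with hD
  set c : ℂ := (∏ i ∈ S, a i) / (∏ i ∈ S, d i) with hc
  have hd0 : (∏ i ∈ S, d i) ≠ 0 := Finset.prod_ne_zero_iff.mpr hd
  have hD0 : (∏ i ∈ S, (d i * x + e i)) ≠ 0 := Finset.prod_ne_zero_iff.mpr hx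
  have hdeg : ∀ a b : ι → ℂ, (∏ i ∈ S, (Polynomial.C (a i) * Polynomial.X + Polynomial.C (b i))).natDegree ≤ S.card := by
    intro a b
    refine (Polynomial.natDegree_prod_le _ _).trans ?_
    refine (Finset.sum_le_sum (fun i _ => Polynomial.natDegree_linear_le)).trans ?_
    simp
  have hco : ∀ a b : ι → ℂ, (∏ i ∈ S, (Polynomial.C (a i) * Polynomial.X + Polynomial.C (b i))).coeff S.card = ∏ i ∈ S, a i := by
    intro a b
    have := Polynomial.coeff_prod_of_natDegree_le S (fun i => Polynomial.C (a i) * Polynomial.X + Polynomial.C (b i)) 1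
      (fun i _ => Polynomial.natDegree_linear_le)
    rw [mul_one] at this
    rw [this]
    refine Finset.prod_congr rfl (fun i _ => ?_)
    simp [Polynomial.coeff_C]
  have hQ : (A - Polynomial.C c * D).degree < (S.card : WithBot ℕ) := by
    rw [Polynomial.degree_lt_iff_coeff_zero]
    intro m hm
    rw [Polynomial.coeff_sub, Polynomial.coeff_C_mul]
    rcases hm.eq_or_lt with rfl | hm
    · rw [hA, hD, hco, hco, hc]; field_simp; ring
    · rw [Polynomial.coeff_eq_zero_of_natDegree_lt ((hdeg a b).trans_lt hm),
        Polynomial.coeff_eq_zero_of_natDegree_lt ((hdeg d e).trans_lt hm)]; simp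
  have hev : ∀ y, A.eval y = ∏ i ∈ S, (a i * y + b i) := by
    intro y; simp [hA, Polynomial.eval_prod]
  have hevD : ∀ y, D.eval y = ∏ i ∈ S, (d i * y + e i) := by
    intro y; simp [hD, Polynomial.eval_prod]
  have hint := Lagrange.eq_interpolate_of_eval_eq (s := S) (v := v)
    (fun i => ∏ j ∈ S, (a j * v i + b j)) (f := A - Polynomial.C c * D) hinj hQ (by
      intro i hi
      have : D.eval (v i) = 0 := by
        rw [hevD]; exact Finset.prod_eq_zero hi (hv i hi)
      simp [this, hev])
  have hE := congrArg (Polynomial.eval x) hint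
  rw [Lagrange.interpolate_apply, Polynomial.eval_finsetSum] at hE
  simp only [Polynomial.eval_sub, Polynomial.eval_mul, Polynomial.eval_C, hev, hevD] at hE
  have : ∀ i ∈ S, (∏ j ∈ S, (a j * v i + b j)) * Polynomial.eval x (Lagrange.basis S v i)
      = ((∏ j ∈ S, (a j * v i + b j))
            / (∏ j ∈ S.erase i, (d j * v i + e j)) / (d i * x + e i)) * (∏ i ∈ S, (d i * x + e i)) := by
    intro i hi
    have h1 : Polynomial.eval x (Lagrange.basis S v i)
        = (∏ j ∈ S.erase i, (d j * x + e j)) / (∏ j ∈ S.erase i, (d j * v i + e j)) := by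
      rw [Lagrange.basis, Polynomial.eval_prod, ← Finset.prod_div_distrib]
      refine Finset.prod_congr rfl (fun j hj => ?_)
      have hjS := Finset.mem_of_mem_erase hj
      have hne : v i - v j ≠ 0 := by
        intro h
        exact (Finset.ne_of_mem_erase hj) (hinj hjS hi (sub_eq_zero.mp h).symm)
      have e1 : e j = - d j * v j := by linear_combination hv j hjS
      have := hd j hjS
      have h2 : d j * v i + -d j * v j ≠ 0 := by
        have : d j * v i + -d j * v j = d j * (v i - v j) := by ring
        rw [this]; positivity
      simp only [Lagrange.basisDivisor, Polynomial.eval_mul, Polynomial.eval_C, Polynomial.eval_sub, Polynomial.eval_X, e1]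
      rw [eq_div_iff h2]
      field_simp
      ring
    rw [h1, ← Finset.mul_prod_erase S (fun i => d i * x + e i) hi]
    have := hx i hi
    generalize (∏ j ∈ S.erase i, (d j * x + e j)) = P1
    generalize (∏ j ∈ S.erase i, (d j * v i + e j)) = P2
    generalize (∏ j ∈ S, (a j * v i + b j)) = P3
    field_simp
  rw [Finset.sum_congr rfl this, ← Finset.sum_mul] at hE
  rw [div_eq_iff hD0, add_mul, ← hE]
  ring


lemma log_succ_diff (j : ℕ) : |Real.log ((j:ℝ)+2) - Real.log ((j:ℝ)+1) - 1/((j:ℝ)+1)| ≤ 1/((j:ℝ)+1)^2 := by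
  have hp : (0:ℝ) < (j:ℝ)+1 := by positivity
  have h0 : Real.log ((j:ℝ)+2) - Real.log ((j:ℝ)+1) = Real.log (1 + 1/((j:ℝ)+1)) := by
    rw [← Real.log_div (by positivity) (by positivity)]
    congr 1; field_simp; ring
  rw [h0]
  set y : ℝ := 1/((j:ℝ)+1) with hy
  have hy0 : 0 < y := by positivity
  have h1 : Real.log (1+y) ≤ y := by
    have := Real.log_le_sub_one_of_pos (show 0 < 1+y by positivity); linarith
  have h2 : y - y^2 ≤ Real.log (1+y) := by
    have := Real.one_sub_inv_le_log_of_pos (show 0 < 1+y by positivity)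
    refine le_trans ?_ this
    have : 1 - (1+y)⁻¹ = y/(1+y) := by field_simp; ring
    rw [this, le_div_iff₀ (by positivity)]
    nlinarith [pow_pos hy0 3]
  have h3 : 1/((j:ℝ)+1)^2 = y^2 := by rw [hy]; field_simp
  rw [h3, abs_le]; constructor <;> linarith [sq_nonneg y]

lemma fac_log (R : ℝ) (hR : 0 ≤ R) : ∃ J : ℕ, ∃ C : ℝ, 0 ≤ C ∧ ∀ z : ℂ, ‖z‖ ≤ R → ∀ j : ℕ, J ≤ j →
    z + j ≠ 0 ∧ |Real.log ‖z + j‖ - (Real.log ((j:ℝ)+1) + (z.re - 1) * (Real.log ((j:ℝ)+2) - Real.log ((j:ℝ)+1)))|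
      ≤ C * (1/((j:ℝ)+1) - 1/((j:ℝ)+2)) := by
  obtain ⟨J, hJ⟩ := exists_nat_ge (2 * (R+1))
  refine ⟨J, 2 * ((R+1)^2 + (R+1)), by positivity, ?_⟩
  intro z hz j hj
  have hp : (0:ℝ) < (j:ℝ)+1 := by positivity
  have hjR : 2 * (R+1) ≤ (j:ℝ)+1 := by
    have : (J:ℝ) ≤ j := by exact_mod_cast hj
    linarith
  set w : ℂ := (z-1)/((j:ℂ)+1) with hw
  have hj0 : ((j:ℂ)+1) ≠ 0 := by exact_mod_cast Nat.succ_ne_zero j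
  have hnj : ‖((j:ℂ)+1)‖ = (j:ℝ)+1 := by
    have : ((j:ℂ)+1) = (((j+1:ℕ):ℝ):ℂ) := by push_cast; ring
    rw [this, Complex.norm_real]; simp; positivity
  have hz1 : ‖z - 1‖ ≤ R+1 := (norm_sub_le _ _).trans (by simpa using hz)
  have hwn : ‖w‖ ≤ (R+1)/((j:ℝ)+1) := by
    rw [hw, norm_div, hnj]; gcongr
  have hwh : ‖w‖ ≤ 1/2 := by
    refine hwn.trans ?_
    rw [div_le_iff₀ hp]; linarith
  have hzj : z + j = ((j:ℂ)+1) * (1 + w) := by rw [hw]; field_simp; ring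
  have h1w : 1 + w ≠ 0 := by
    intro h
    have : w = -1 := by linear_combination h
    rw [this] at hwh; norm_num at hwh
  refine ⟨by rw [hzj]; exact mul_ne_zero hj0 h1w, ?_⟩
  rw [hzj, norm_mul, hnj, Real.log_mul hp.ne' (norm_ne_zero_iff.mpr h1w)]
  have hl := norm_log_one_add_sub_self_le (z := w) (by linarith)
  have hl2 : ‖w‖^2 * (1-‖w‖)⁻¹/2 ≤ ‖w‖^2 := by
    have : (1-‖w‖)⁻¹ ≤ 2 := by
      rw [inv_le_comm₀ (by linarith) (by norm_num)]; linarith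
    nlinarith [sq_nonneg ‖w‖]
  have hre : |(log (1+w)).re - w.re| ≤ ((R+1)/((j:ℝ)+1))^2 := by
    rw [← Complex.sub_re]
    refine (Complex.abs_re_le_norm _).trans (hl.trans (hl2.trans ?_))
    gcongr
  rw [Complex.log_re] at hre
  have hwre : w.re = (z.re - 1) * (1/((j:ℝ)+1)) := by
    have : w = ((1/((j:ℝ)+1) : ℝ):ℂ) * (z - 1) := by rw [hw]; push_cast; ring
    rw [this, Complex.re_ofReal_mul]; simp; ring
  have hd := log_succ_diff j
  have hzre : |z.re - 1| ≤ R+1 := by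
    have := Complex.abs_re_le_norm (z-1)
    simp at this; linarith
  have hd2 : |(z.re-1) * (Real.log ((j:ℝ)+2) - Real.log ((j:ℝ)+1) - 1/((j:ℝ)+1))| ≤ (R+1) * (1/((j:ℝ)+1)^2) := by
    rw [abs_mul]; gcongr
  have hfin : ((R+1)/((j:ℝ)+1))^2 + (R+1) * (1/((j:ℝ)+1)^2) ≤ 2 * ((R+1)^2 + (R+1)) * (1/((j:ℝ)+1) - 1/((j:ℝ)+2)) := by
    have e1 : ((R+1)/((j:ℝ)+1))^2 + (R+1) * (1/((j:ℝ)+1)^2) = ((R+1)^2 + (R+1)) * (1/((j:ℝ)+1)^2) := by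
      field_simp
    have e2 : 1/((j:ℝ)+1)^2 ≤ 2 * (1/((j:ℝ)+1) - 1/((j:ℝ)+2)) := by
      have : 1/((j:ℝ)+1) - 1/((j:ℝ)+2) = 1/(((j:ℝ)+1)*((j:ℝ)+2)) := by field_simp; ring
      rw [this, ← mul_div_assoc, mul_one, div_le_div_iff₀ (by positivity) (by positivity)]
      nlinarith
    rw [e1]
    calc _ ≤ ((R+1)^2 + (R+1)) * (2 * (1/((j:ℝ)+1) - 1/((j:ℝ)+2))) := by gcongr
      _ = _ := by ring
  refine le_trans ?_ hfin
  rw [hwre] at hre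
  have e : Real.log ((j:ℝ)+1) + Real.log ‖1+w‖ - (Real.log ((j:ℝ)+1) + (z.re - 1) * (Real.log ((j:ℝ)+2) - Real.log ((j:ℝ)+1)))
    = (Real.log ‖1+w‖ - (z.re - 1) * (1/((j:ℝ)+1))) - (z.re-1) * (Real.log ((j:ℝ)+2) - Real.log ((j:ℝ)+1) - 1/((j:ℝ)+1)) := by ring
  rw [e]
  exact (abs_sub _ _).trans (add_le_add hre hd2)

/-- exponent of a single factor -/
lemma small_facts (R : ℝ) (hR : 0 ≤ R) (z : ℂ) (hz : ‖z‖ ≤ R) (j J : ℕ) (hj : j < J) :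
    |(z.re - 1) * (Real.log ((j:ℝ)+2) - Real.log ((j:ℝ)+1))| ≤ 2*(R+1) ∧ 0 ≤ Real.log ((j:ℝ)+1) ∧
    Real.log ((j:ℝ)+1) ≤ J ∧ 1/(((J:ℝ)+1)*((J:ℝ)+2)) ≤ 1/((j:ℝ)+1) - 1/((j:ℝ)+2) := by
  have hp : (0:ℝ) < (j:ℝ)+1 := by positivity
  have hjJ : (j:ℝ) + 1 ≤ J := by exact_mod_cast hj
  refine ⟨?_, Real.log_nonneg (by linarith [(Nat.cast_nonneg j : (0:ℝ) ≤ j)]), ?_, ?_⟩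
  · rw [abs_mul]
    have hzre : |z.re - 1| ≤ R+1 := by
      have := Complex.abs_re_le_norm (z-1)
      have h2 : ‖z - 1‖ ≤ R+1 := (norm_sub_le _ _).trans (by simpa using hz)
      simp at this; linarith
    have hd := log_succ_diff j
    have : 1/((j:ℝ)+1) ≤ 1 := by rw [div_le_one hp]; linarith [(Nat.cast_nonneg j : (0:ℝ) ≤ j)]
    have h3 : 1/((j:ℝ)+1)^2 ≤ 1 := by
      rw [div_le_one (by positivity)]; nlinarith [(Nat.cast_nonneg j : (0:ℝ) ≤ j)]
    have h4 : 0 < 1/((j:ℝ)+1) := by positivity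
    rw [abs_le] at hd
    have : |Real.log ((j:ℝ)+2) - Real.log ((j:ℝ)+1)| ≤ 2 := by
      rw [abs_le]; constructor <;> linarith
    calc _ ≤ (R+1) * 2 := by gcongr
      _ = _ := by ring
  · have := Real.log_le_sub_one_of_pos hp; linarith
  · have : 1/((j:ℝ)+1) - 1/((j:ℝ)+2) = 1/(((j:ℝ)+1)*((j:ℝ)+2)) := by field_simp; ring
    rw [this]
    gcongr

lemma fac_upper (R : ℝ) (hR : 0 ≤ R) : ∃ C : ℝ, 0 ≤ C ∧ ∀ z : ℂ, ‖z‖ ≤ R → ∀ j : ℕ,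
    ‖z + j‖ ≤ Real.exp (C * (1/((j:ℝ)+1) - 1/((j:ℝ)+2)) + (Real.log ((j:ℝ)+1) + (z.re - 1) * (Real.log ((j:ℝ)+2) - Real.log ((j:ℝ)+1)))) := by
  obtain ⟨J, C, hC, h⟩ := fac_log R hR
  refine ⟨C + (R + J + 2*(R+1)) * (((J:ℝ)+1)*((J:ℝ)+2)), by positivity, ?_⟩
  intro z hz j
  have hpos : 0 ≤ 1/((j:ℝ)+1) - 1/((j:ℝ)+2) := by
    rw [sub_nonneg]; gcongr; norm_num
  rcases le_or_gt J j with hj | hj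
  · obtain ⟨h0, h1⟩ := h z hz j hj
    rw [← Real.log_le_iff_le_exp (norm_pos_iff.mpr h0)]
    have := (abs_le.mp h1).2
    have : 0 ≤ (R + J + 2*(R+1)) * (((J:ℝ)+1)*((J:ℝ)+2)) * (1/((j:ℝ)+1) - 1/((j:ℝ)+2)) := by positivity
    linarith
  · obtain ⟨h1, h2, h3, h4⟩ := small_facts R hR z hz j J hj
    have hn : ‖z + j‖ ≤ R + J := by
      refine (norm_add_le _ _).trans (add_le_add hz ?_)
      simp; exact_mod_cast hj.le
    refine hn.trans ((by linarith [Real.add_one_le_exp (R+J)] : R + J ≤ Real.exp (R+J)).trans ?_)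
    rw [Real.exp_le_exp]
    have h5 : (R + J + 2*(R+1)) ≤ (R + J + 2*(R+1)) * (((J:ℝ)+1)*((J:ℝ)+2)) * (1/((j:ℝ)+1) - 1/((j:ℝ)+2)) := by
      calc (R + J + 2*(R+1)) = (R + J + 2*(R+1)) * (((J:ℝ)+1)*((J:ℝ)+2)) * (1/(((J:ℝ)+1)*((J:ℝ)+2))) := by field_simp
        _ ≤ _ := by gcongr
    have h6 : 0 ≤ C * (1/((j:ℝ)+1) - 1/((j:ℝ)+2)) := by positivity
    have := (abs_le.mp h1).1
    linarith

lemma fac_lower (R δ : ℝ) (hR : 0 ≤ R) (hδ : 0 < δ) : ∃ C : ℝ, 0 ≤ C ∧ ∀ z : ℂ, ‖z‖ ≤ R → ∀ j : ℕ, δ ≤ ‖z + j‖ →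
     Real.exp (-(C * (1/((j:ℝ)+1) - 1/((j:ℝ)+2))) + (Real.log ((j:ℝ)+1) + (z.re - 1) * (Real.log ((j:ℝ)+2) - Real.log ((j:ℝ)+1))))
      ≤ ‖z + j‖ := by
  obtain ⟨J, C, hC, h⟩ := fac_log R hR
  refine ⟨C + (|Real.log δ| + J + 2*(R+1)) * (((J:ℝ)+1)*((J:ℝ)+2)), by positivity, ?_⟩
  intro z hz j hzj
  have hpos : 0 ≤ 1/((j:ℝ)+1) - 1/((j:ℝ)+2) := by
    rw [sub_nonneg]; gcongr; norm_num
  rcases le_or_gt J j with hj | hj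
  · obtain ⟨h0, h1⟩ := h z hz j hj
    rw [← Real.le_log_iff_exp_le (norm_pos_iff.mpr h0)]
    have := (abs_le.mp h1).1
    have : 0 ≤ (|Real.log δ| + J + 2*(R+1)) * (((J:ℝ)+1)*((J:ℝ)+2)) * (1/((j:ℝ)+1) - 1/((j:ℝ)+2)) := by positivity
    linarith
  · obtain ⟨h1, h2, h3, h4⟩ := small_facts R hR z hz j J hj
    refine le_trans ?_ hzj
    rw [← Real.le_log_iff_exp_le hδ]
    have h5 : (|Real.log δ| + J + 2*(R+1)) ≤ (|Real.log δ| + J + 2*(R+1)) * (((J:ℝ)+1)*((J:ℝ)+2)) * (1/((j:ℝ)+1) - 1/((j:ℝ)+2)) := by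
      calc (|Real.log δ| + J + 2*(R+1)) = (|Real.log δ| + J + 2*(R+1)) * (((J:ℝ)+1)*((J:ℝ)+2)) * (1/(((J:ℝ)+1)*((J:ℝ)+2))) := by field_simp
        _ ≤ _ := by gcongr
    have h6 : 0 ≤ C * (1/((j:ℝ)+1) - 1/((j:ℝ)+2)) := by positivity
    have := (abs_le.mp h1).2
    have := neg_abs_le (Real.log δ)
    linarith


noncomputable def poch (z : ℂ) (m : ℕ) : ℂ := ∏ j ∈ Finset.range m, (z + j)

noncomputable def lf (n : ℕ) : ℝ := Real.log (n.factorial : ℝ)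

lemma lf_succ (n : ℕ) : lf (n+1) = lf n + Real.log ((n:ℝ)+1) := by
  unfold lf
  rw [Nat.factorial_succ]; push_cast
  rw [Real.log_mul (by positivity) (by positivity)]; ring

lemma lf_zero : lf 0 = 0 := by simp [lf]

lemma lf_nonneg (n : ℕ) : 0 ≤ lf n := by
  unfold lf; apply Real.log_nonneg
  exact_mod_cast Nat.factorial_pos n

lemma exp_lf (n : ℕ) : Real.exp (lf n) = n.factorial := by
  unfold lf; rw [Real.exp_log]; positivity

lemma poch_succ (z : ℂ) (m : ℕ) : poch z (m+1) = poch z m * (z + m) := by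
  unfold poch; rw [Finset.prod_range_succ]

lemma poch_add (z : ℂ) (m l : ℕ) : poch z (m+l) = poch z m * poch (z + m) l := by
  unfold poch; rw [Finset.prod_range_add]
  congr 1
  refine Finset.prod_congr rfl (fun j _ => ?_)
  push_cast; ring

lemma poch_refl (v : ℂ) (d m : ℕ) : ‖poch (v - ((d + m : ℕ):ℂ)) m‖ = ‖poch (1 - v + d) m‖ := by
  unfold poch
  rw [norm_prod, norm_prod, ← Finset.prod_range_reflect]
  refine Finset.prod_congr rfl (fun j hj => ?_)
  rw [Finset.mem_range] at hj
  rw [← norm_neg]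
  congr 1
  have : ((m - 1 - j : ℕ):ℂ) = m - 1 - j := by
    rw [Nat.cast_sub (by omega), Nat.cast_sub (by omega)]; simp
  rw [this]; push_cast; ring

lemma U0 (R : ℝ) (hR : 0 ≤ R) : ∃ C : ℝ, 0 ≤ C ∧ ∀ z : ℂ, ‖z‖ ≤ R → ∀ k m : ℕ,
    ‖poch (z + k) m‖ ≤ Real.exp (C + lf (k+m) - lf k + (z.re - 1) * (Real.log ((k:ℝ)+m+1) - Real.log ((k:ℝ)+1))) := by
  obtain ⟨C, hC, h⟩ := fac_upper R hR
  refine ⟨C, hC, ?_⟩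
  intro z hz k m
  have key : ‖poch (z + k) m‖ ≤ Real.exp (C * (1/((k:ℝ)+1) - 1/((k:ℝ)+m+1)) + lf (k+m) - lf k + (z.re - 1) * (Real.log ((k:ℝ)+m+1) - Real.log ((k:ℝ)+1))) := by
    induction m with
    | zero => simp [poch]
    | succ m ih =>
      rw [poch_succ, norm_mul]
      have h1 := h z hz (k+m)
      have e1 : z + ((k+m:ℕ):ℂ) = z + k + m := by push_cast; ring
      rw [e1] at h1
      refine (mul_le_mul ih h1 (norm_nonneg _) (Real.exp_pos _).le).trans ?_
      rw [← Real.exp_add, Real.exp_le_exp, ← add_assoc k m 1, lf_succ]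
      push_cast
      have e2 : (k:ℝ)+m+2 = k+(m+1)+1 := by ring
      rw [e2]
      apply le_of_eq; ring
  refine key.trans ?_
  rw [Real.exp_le_exp]
  have h1 : 1/((k:ℝ)+1) ≤ 1 := by
    rw [div_le_one (by positivity)]; linarith [(Nat.cast_nonneg k : (0:ℝ) ≤ k)]
  have h2 : 0 ≤ 1/((k:ℝ)+m+1) := by positivity
  have : C * (1/((k:ℝ)+1) - 1/((k:ℝ)+m+1)) ≤ C * 1 := by gcongr; linarith
  linarith

lemma L0 (R δ : ℝ) (hR : 0 ≤ R) (hδ : 0 < δ) : ∃ C : ℝ, 0 ≤ C ∧ ∀ z : ℂ, ‖z‖ ≤ R → ∀ k m : ℕ,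
    (∀ j : ℕ, δ ≤ ‖z + k + j‖) →
    Real.exp (-C + lf (k+m) - lf k + (z.re - 1) * (Real.log ((k:ℝ)+m+1) - Real.log ((k:ℝ)+1))) ≤ ‖poch (z + k) m‖ := by
  obtain ⟨C, hC, h⟩ := fac_lower R δ hR hδ
  refine ⟨C, hC, ?_⟩
  intro z hz k m hzk
  have key : Real.exp (-(C * (1/((k:ℝ)+1) - 1/((k:ℝ)+m+1))) + lf (k+m) - lf k + (z.re - 1) * (Real.log ((k:ℝ)+m+1) - Real.log ((k:ℝ)+1))) ≤ ‖poch (z + k) m‖ := by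
    induction m with
    | zero => simp [poch]
    | succ m ih =>
      rw [poch_succ, norm_mul]
      have e1 : z + ((k+m:ℕ):ℂ) = z + k + m := by push_cast; ring
      have h1 := h z hz (k+m) (by rw [e1]; exact hzk m)
      rw [e1] at h1
      refine le_trans ?_ (mul_le_mul ih h1 (Real.exp_pos _).le (norm_nonneg _))
      rw [← Real.exp_add, Real.exp_le_exp, ← add_assoc k m 1, lf_succ]
      push_cast
      have e2 : (k:ℝ)+m+2 = k+(m+1)+1 := by ring
      rw [e2]
      apply le_of_eq; ring
  refine le_trans ?_ key
  rw [Real.exp_le_exp]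
  have h1 : 1/((k:ℝ)+1) ≤ 1 := by
    rw [div_le_one (by positivity)]; linarith [(Nat.cast_nonneg k : (0:ℝ) ≤ k)]
  have h2 : 0 ≤ 1/((k:ℝ)+m+1) := by positivity
  have : C * (1/((k:ℝ)+1) - 1/((k:ℝ)+m+1)) ≤ C * 1 := by gcongr; linarith
  linarith

lemma log_cmp (x y c : ℝ) (hy : 0 < y) (hx : 0 < x) (hc : 0 < c) (h : x ≤ c * y) : Real.log x ≤ Real.log y + Real.log c := by
  rw [add_comm, ← Real.log_mul hc.ne' hy.ne']
  exact Real.log_le_log hx h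

lemma lf_bounds (p r n k : ℕ) (hk : k ≤ n + r) :
    lf (k+n) + p * Real.log ((n:ℝ)+1) ≤ lf (k+n+p) ∧
    lf (k+n+p) ≤ lf (k+n) + p * Real.log ((n:ℝ)+1) + p * Real.log ((p:ℝ)+r+2) := by
  have main : ∀ i ≤ p, lf (k+n) + i * Real.log ((n:ℝ)+1) ≤ lf (k+n+i) ∧
    lf (k+n+i) ≤ lf (k+n) + i * Real.log ((n:ℝ)+1) + i * Real.log ((p:ℝ)+r+2) := by
    intro i
    induction i with
    | zero => intro _; simp
    | succ i ih =>
      intro hi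
      obtain ⟨h1, h2⟩ := ih (by omega)
      rw [← add_assoc, lf_succ]
      push_cast
      have a1 : Real.log ((n:ℝ)+1) ≤ Real.log ((k:ℝ)+n+i+1) := by
        apply Real.log_le_log (by positivity)
        have : (0:ℝ) ≤ k := by positivity
        have : (0:ℝ) ≤ i := by positivity
        linarith
      have a2 : Real.log ((k:ℝ)+n+i+1) ≤ Real.log ((n:ℝ)+1) + Real.log ((p:ℝ)+r+2) := by
        apply log_cmp _ _ _ (by positivity) (by positivity) (by positivity)
        have h1 : (k:ℝ) ≤ n + r := by exact_mod_cast hk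
        have h2 : (i:ℝ)+1 ≤ p := by exact_mod_cast hi
        have : (0:ℝ) ≤ n := by positivity
        have : (0:ℝ) ≤ p := by positivity
        have : (0:ℝ) ≤ r := by positivity
        nlinarith
      constructor <;> linarith
  exact main p le_rfl

lemma log_bounds (p r n k : ℕ) (hk : k ≤ n + r) :
    |Real.log ((k:ℝ)+((n+p:ℕ):ℝ)+1) - Real.log ((n:ℝ)+1)| ≤ Real.log ((p:ℝ)+r+2) := by
  have h1 : (k:ℝ) ≤ n + r := by exact_mod_cast hk
  have h3 : (0:ℝ) ≤ n := by positivity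
  have h4 : (0:ℝ) ≤ p := by positivity
  have h6 : (0:ℝ) ≤ r := by positivity
  have h5 : (0:ℝ) ≤ k := by positivity
  push_cast
  have a1 : Real.log ((n:ℝ)+1) ≤ Real.log ((k:ℝ)+(n+p)+1) := by
    apply Real.log_le_log (by positivity)
    linarith
  have a2 : Real.log ((k:ℝ)+(n+p)+1) ≤ Real.log ((n:ℝ)+1) + Real.log ((p:ℝ)+r+2) := by
    apply log_cmp _ _ _ (by positivity) (by positivity) (by positivity)
    nlinarith
  have : 0 ≤ Real.log ((p:ℝ)+r+2) := Real.log_nonneg (by linarith)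
  rw [abs_le]; constructor <;> linarith

lemma mul_bd (x y A B : ℝ) (hx : |x| ≤ A) (hy : |y| ≤ B) : |x * y| ≤ A * B := by
  rw [abs_mul]
  exact mul_le_mul hx hy (abs_nonneg _) ((abs_nonneg _).trans hx)

lemma re_sub_one_bd (z : ℂ) (R : ℝ) (hz : ‖z‖ ≤ R) : |z.re - 1| ≤ R + 1 := by
  have := Complex.abs_re_le_norm (z-1)
  have h2 : ‖z - 1‖ ≤ R+1 := (norm_sub_le _ _).trans (by simpa using hz)
  simp at this; linarith

lemma U1 (R : ℝ) (hR : 0 ≤ R) (p r : ℕ) : ∃ C : ℝ, ∀ z : ℂ, ‖z‖ ≤ R → ∀ n k : ℕ, k ≤ n + r →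
    ‖poch (z + k) (n+p)‖ ≤ Real.exp (C + lf (k+n) - lf k + p * Real.log ((n:ℝ)+1)
      + (z.re - 1) * (Real.log ((n:ℝ)+1) - Real.log ((k:ℝ)+1))) := by
  obtain ⟨C, hC, h⟩ := U0 R hR
  refine ⟨C + p * Real.log ((p:ℝ)+r+2) + (R+1) * Real.log ((p:ℝ)+r+2), ?_⟩
  intro z hz n k hk
  refine (h z hz k (n+p)).trans ?_
  rw [Real.exp_le_exp, ← add_assoc k n p]
  have h1 := (lf_bounds p r n k hk).2
  have h2 := mul_bd _ _ _ _ (re_sub_one_bd z R hz) (log_bounds p r n k hk)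
  have := (abs_le.mp h2).2
  linarith

lemma L1 (R δ : ℝ) (hR : 0 ≤ R) (hδ : 0 < δ) (p r : ℕ) : ∃ C : ℝ, ∀ z : ℂ, ‖z‖ ≤ R → ∀ n k : ℕ, k ≤ n + r →
    (∀ j : ℕ, δ ≤ ‖z + k + j‖) →
    Real.exp (C + lf (k+n) - lf k + p * Real.log ((n:ℝ)+1)
      + (z.re - 1) * (Real.log ((n:ℝ)+1) - Real.log ((k:ℝ)+1))) ≤ ‖poch (z + k) (n+p)‖ := by
  obtain ⟨C, hC, h⟩ := L0 R δ hR hδ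
  refine ⟨-C - (R+1) * Real.log ((p:ℝ)+r+2), ?_⟩
  intro z hz n k hk hzk
  refine le_trans ?_ (h z hz k (n+p) hzk)
  rw [Real.exp_le_exp, ← add_assoc k n p]
  have h1 := (lf_bounds p r n k hk).1
  have h2 := mul_bd _ _ _ _ (re_sub_one_bd z R hz) (log_bounds p r n k hk)
  have := (abs_le.mp h2).1
  linarith

lemma cmpN (p q N N' : ℕ) (h : N + p = N' + q) :
    |Real.log ((N:ℝ)+1) - Real.log ((N':ℝ)+1)| ≤ Real.log ((p:ℝ)+q+1) ∧
    lf N ≤ lf N' + ((q:ℝ) - p) * Real.log ((N':ℝ)+1) + (q * Real.log ((q:ℝ)+q+2) + p * Real.log ((p:ℝ)+q+1)) := by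
  have hc : (N:ℝ) + p = N' + q := by exact_mod_cast h
  have b1 : (0:ℝ) ≤ N := by positivity
  have b2 : (0:ℝ) ≤ N' := by positivity
  have b3 : (0:ℝ) ≤ p := by positivity
  have b4 : (0:ℝ) ≤ q := by positivity
  have a1 : Real.log ((N:ℝ)+1) ≤ Real.log ((N':ℝ)+1) + Real.log ((p:ℝ)+q+1) := by
    apply log_cmp _ _ _ (by positivity) (by positivity) (by positivity)
    nlinarith
  have a2 : Real.log ((N':ℝ)+1) ≤ Real.log ((N:ℝ)+1) + Real.log ((p:ℝ)+q+1) := by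
    apply log_cmp _ _ _ (by positivity) (by positivity) (by positivity)
    nlinarith
  refine ⟨by rw [abs_le]; constructor <;> linarith, ?_⟩
  have h1 := (lf_bounds p 0 N 0 (by omega)).1
  have h2 := (lf_bounds q q N' 0 (by omega)).2
  simp only [zero_add] at h1 h2
  rw [h] at h1
  have : (p:ℝ) * Real.log ((N':ℝ)+1) ≤ p * (Real.log ((N:ℝ)+1) + Real.log ((p:ℝ)+q+1)) := by gcongr
  linarith

lemma B1 (R : ℝ) (hR : 0 ≤ R) (p q : ℕ) : ∃ C : ℝ, ∀ v : ℂ, ‖v‖ ≤ R → ∀ n k : ℕ, k < n + p →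
    ‖poch (v - k) (n+q)‖ ≤ Real.exp (C + lf k - v.re * Real.log ((k:ℝ)+1) + lf (n+p-k)
      + (v.re - 1 + q - p) * Real.log (((n+p-k:ℕ):ℝ)+1)) := by
  obtain ⟨C, hC, h⟩ := U0 (R+1) (by linarith)
  set G := Real.log ((p:ℝ)+q+1) with hG
  have hG0 : 0 ≤ G := Real.log_nonneg (by
    have b3 : (0:ℝ) ≤ p := by positivity
    have b4 : (0:ℝ) ≤ q := by positivity
    linarith)
  have hG2 : 0 ≤ Real.log ((q:ℝ)+q+2) := Real.log_nonneg (by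
    have b4 : (0:ℝ) ≤ q := by positivity
    linarith)
  refine ⟨2*C + (q * Real.log ((q:ℝ)+q+2) + p * G) + (R+1) * G + R * G + (R+1+q+p) * G, ?_⟩
  intro v hv n k hk
  have h1v : ‖1 - v‖ ≤ R + 1 := (norm_sub_le _ _).trans (by simp; linarith)
  have hvre := re_sub_one_bd v R hv
  have hvre' : |v.re| ≤ R := (Complex.abs_re_le_norm v).trans hv
  have e1 : (1-v).re - 1 = - v.re := by simp
  have hn1 : 0 ≤ (q * Real.log ((q:ℝ)+q+2) + p * G) := by positivity
  have hn2 : 0 ≤ (R+1) * G := by positivity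
  have hn3 : 0 ≤ R * G := by positivity
  have hn4 : 0 ≤ (R+1+q+p) * G := by positivity
  rcases le_or_gt k (n+q) with hkq | hkq
  · obtain ⟨N, hN⟩ := Nat.exists_eq_add_of_le hkq
    obtain ⟨N', hN'⟩ := Nat.exists_eq_add_of_le hk.le
    have : n + p - k = N' := by omega
    rw [this, hN, poch_add, norm_mul]
    have r := poch_refl v 0 k
    simp only [zero_add, Nat.cast_zero] at r
    have r1 := h (1-v) h1v 0 k
    simp only [zero_add, Nat.cast_zero, e1, lf_zero, Real.log_one] at r1
    rw [r]
    have r2 := h v (by linarith) 0 N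
    simp only [zero_add, Nat.cast_zero, add_zero, lf_zero, Real.log_one] at r2
    rw [sub_add_cancel]
    refine (mul_le_mul r1 r2 (norm_nonneg _) (Real.exp_pos _).le).trans ?_
    rw [← Real.exp_add, Real.exp_le_exp]
    obtain ⟨c1, c2⟩ := cmpN p q N N' (by omega)
    have c3 := (abs_le.mp (mul_bd _ _ _ _ hvre c1)).2
    linarith
  · obtain ⟨d, hd⟩ := Nat.exists_eq_add_of_lt hkq
    obtain ⟨N', hN'⟩ := Nat.exists_eq_add_of_le hk.le
    have e2 : n + p - k = N' := by omega
    have e3 : k = (d + 1) + (n + q) := by omega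
    have r := poch_refl v (d+1) (n+q)
    rw [← e3] at r
    rw [e2, r]
    have r1 := h (1-v) h1v (d+1) (n+q)
    rw [← e3, e1] at r1
    refine r1.trans ?_
    rw [Real.exp_le_exp]
    have e4 : ((d+1:ℕ):ℝ) + ((n+q:ℕ):ℝ) = k := by rw [e3]; push_cast; ring
    rw [e4]
    have f1 := lf_nonneg (d+1)
    have f2 := lf_nonneg N'
    have f3 : |Real.log (((d+1:ℕ):ℝ)+1)| ≤ G := by
      rw [abs_of_nonneg (Real.log_nonneg (by push_cast; linarith [(Nat.cast_nonneg d : (0:ℝ) ≤ d)]))]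
      apply Real.log_le_log (by positivity)
      have : d + 1 ≤ p + q := by omega
      have : ((d+1:ℕ):ℝ) ≤ p + q := by exact_mod_cast this
      linarith
    have f4 : |Real.log ((N':ℝ)+1)| ≤ G := by
      rw [abs_of_nonneg (Real.log_nonneg (by linarith [(Nat.cast_nonneg N' : (0:ℝ) ≤ N')]))]
      apply Real.log_le_log (by positivity)
      have : N' ≤ p + q := by omega
      have : (N':ℝ) ≤ p + q := by exact_mod_cast this
      linarith
    have f5 := (abs_le.mp (mul_bd _ _ _ _ hvre' f3)).2
    have f6 : |v.re - 1 + q - p| ≤ R+1+q+p := by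
      have b3 : (0:ℝ) ≤ p := by positivity
      have b4 : (0:ℝ) ≤ q := by positivity
      rw [abs_le] at hvre ⊢
      constructor <;> linarith
    have f7 := (abs_le.mp (mul_bd _ _ _ _ f6 f4)).1
    linarith


noncomputable def Phi (p0 p1 p2 p3 p4 p5 : ℕ) (A B V Y Z : ℂ) (n k : ℕ) : ℂ :=
  1 / ((k.factorial : ℂ) * ((n + p0 - 1 - k).factorial : ℂ)) *
    (poch (A + k) (n + p1) * poch B (n + p2) * poch (V - k) (n + p3)
      / (poch Y (n + p4) * poch (Z + k) (n + p5)))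

lemma comb_exp {s x1 x2 x3 y1 y2 w a1 a2 a3 b1 b2 c l1 l2 : ℝ}
    (h1 : x1 ≤ Real.exp a1) (h2 : x2 ≤ Real.exp a2) (h3 : x3 ≤ Real.exp a3)
    (h4 : Real.exp b1 ≤ y1) (h5 : Real.exp b2 ≤ y2) (h6 : w ≤ Real.exp c)
    (n1 : 0 ≤ x1) (n2 : 0 ≤ x2) (n3 : 0 ≤ x3) (n6 : 0 ≤ w) :
    Real.exp s * (1 / (Real.exp l1 * Real.exp l2) * (x1 * x2 * x3 / (y1 * y2))) * w
      ≤ Real.exp (s - l1 - l2 + a1 + a2 + a3 - b1 - b2 + c) := by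
  have : Real.exp (s - l1 - l2 + a1 + a2 + a3 - b1 - b2 + c)
      = Real.exp s * (1 / (Real.exp l1 * Real.exp l2) * (Real.exp a1 * Real.exp a2 * Real.exp a3 / (Real.exp b1 * Real.exp b2))) * Real.exp c := by
    simp only [Real.exp_add, Real.exp_sub]
    field_simp
  rw [this]
  have n4 : 0 < y1 := (Real.exp_pos _).trans_le h4
  have n5 : 0 < y2 := (Real.exp_pos _).trans_le h5
  gcongr

lemma Phi_bound (p0 p1 p2 p3 p4 p5 : ℕ) (σ0 a R δ E W : ℝ) (hR : 0 ≤ R) (hδ : 0 < δ) (hE : 0 ≤ E)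
    (A B V Y Z w : ℕ → ℂ)
    (hA : ∀ k, ‖A k‖ ≤ R) (hB : ∀ k, ‖B k‖ ≤ R) (hV : ∀ k, ‖V k‖ ≤ R) (hY : ∀ k, ‖Y k‖ ≤ R) (hZ : ∀ k, ‖Z k‖ ≤ R)
    (hYδ : ∀ k j : ℕ, δ ≤ ‖Y k + j‖) (hZδ : ∀ k j : ℕ, δ ≤ ‖Z k + k + j‖)
    (hw : ∀ k : ℕ, ‖w k‖ ≤ W / ((k:ℝ)+1))
    (hL : ∀ k, (A k).re + (B k).re + (V k).re - (Y k).re - (Z k).re + σ0 + ((p1:ℝ)+p2+p3-p0-p4-p5) = 0)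
    (hK : ∀ k : ℕ, |(A k).re + (V k).re - (Z k).re - a| ≤ E / ((k:ℝ)+1))
    (hb : ∀ k : ℕ, -1 - E / ((k:ℝ)+1) ≤ (V k).re + p3 - p0) :
    ∃ C : ℝ, ∀ n k : ℕ, k < n + p0 →
      Real.exp (σ0 * Real.log ((n:ℝ)+1)) * ‖Phi p0 p1 p2 p3 p4 p5 (A k) (B k) (V k) (Y k) (Z k) n k‖ * ‖w k‖
        ≤ Real.exp (C + (-1-a) * Real.log ((k:ℝ)+1) + Real.log ((n:ℝ)+1) - Real.log (((n+p0-k:ℕ):ℝ)+1)) := by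
  obtain ⟨cA, uA⟩ := U1 R hR p1 p0
  obtain ⟨cB, uB⟩ := U1 R hR p2 p0
  obtain ⟨cV, uV⟩ := B1 R hR p0 p3
  obtain ⟨cY, uY⟩ := L1 R δ hR hδ p4 p0
  obtain ⟨cZ, uZ⟩ := L1 R δ hR hδ p5 p0
  set G := Real.log ((p0:ℝ)+1) with hG
  have hG0 : 0 ≤ G := Real.log_nonneg (by linarith [(Nat.cast_nonneg p0 : (0:ℝ) ≤ p0)])
  refine ⟨cA + cB + cV - cY - cZ + W + E + E + (R + p3 + p0 + 1) * G, ?_⟩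
  intro n k hk
  set L := Real.log ((n:ℝ)+1) with hLd
  set K := Real.log ((k:ℝ)+1) with hKd
  set D := Real.log (((n+p0-k:ℕ):ℝ)+1) with hDd
  have hn0 : (0:ℝ) ≤ n := by positivity
  have hk0 : (0:ℝ) ≤ k := by positivity
  have hp0 : (0:ℝ) ≤ p0 := by positivity
  have hp3 : (0:ℝ) ≤ p3 := by positivity
  have hL0 : 0 ≤ L := Real.log_nonneg (by linarith)
  have hK0 : 0 ≤ K := Real.log_nonneg (by linarith)
  have hKk : K ≤ (k:ℝ)+1 := by
    have := Real.log_le_sub_one_of_pos (show 0 < (k:ℝ)+1 by positivity); linarith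
  have hdd : ((n+p0-k:ℕ):ℝ) = n + p0 - k := by
    rw [Nat.cast_sub hk.le]; push_cast; ring
  have hd1 : (1:ℝ) ≤ ((n+p0-k:ℕ):ℝ) := by
    have : 1 ≤ n + p0 - k := by omega
    exact_mod_cast this
  have hDL : D ≤ L + G := by
    apply log_cmp _ _ _ (by positivity) (by positivity) (by positivity)
    rw [hdd]; nlinarith
  have hLD : L ≤ D + K := by
    apply log_cmp _ _ _ (by positivity) (by positivity) (by positivity)
    have : (n:ℝ) ≤ k + ((n+p0-k:ℕ):ℝ) := by rw [hdd]; linarith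
    nlinarith
  -- the individual estimates
  have eA := uA (A k) (hA k) n k hk.le
  have eB := uB (B k) (hB k) n 0 (by omega)
  have eV := uV (V k) (hV k) n k hk
  have eY := uY (Y k) (hY k) n 0 (by omega) (by simpa using hYδ k)
  have eZ := uZ (Z k) (hZ k) n k hk.le (hZδ k)
  simp only [Nat.cast_zero, add_zero, zero_add, lf_zero, Real.log_one, sub_zero] at eB eY
  have eW : ‖w k‖ ≤ Real.exp (W - K) := by
    refine (hw k).trans ?_
    rw [Real.exp_sub, hKd, Real.exp_log (by positivity)]
    gcongr
    linarith [Real.add_one_le_exp W]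
  have hfac : lf (n + p0 - k) ≤ lf (n+p0-1-k) + D := by
    have e : n + p0 - k = (n + p0 - 1 - k) + 1 := by omega
    rw [hDd, e, lf_succ]
    gcongr
    push_cast; linarith
  have hPhi : ‖Phi p0 p1 p2 p3 p4 p5 (A k) (B k) (V k) (Y k) (Z k) n k‖
      = (1 / (Real.exp (lf k) * Real.exp (lf (n+p0-1-k)))) *
        (‖poch (A k + k) (n + p1)‖ * ‖poch (B k) (n + p2)‖ * ‖poch (V k - k) (n + p3)‖
      / (‖poch (Y k) (n + p4)‖ * ‖poch (Z k + k) (n + p5)‖)) := by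
    unfold Phi
    rw [exp_lf, exp_lf]
    simp only [norm_mul, norm_div, norm_one, Complex.norm_natCast]
  rw [hPhi]
  refine (comb_exp eA eB eV eY eZ eW (norm_nonneg _) (norm_nonneg _) (norm_nonneg _) (norm_nonneg _)).trans ?_
  rw [Real.exp_le_exp]
  have hEk : E / ((k:ℝ)+1) * K ≤ E := by
    rw [div_mul_eq_mul_div, div_le_iff₀ (by positivity)]
    gcongr
  have m1 : -((A k).re + (V k).re - (Z k).re - a) * K ≤ E := by
    refine le_trans ?_ hEk
    gcongr
    exact (neg_le_abs _).trans (hK k)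
  have m2 : ((V k).re + p3 - p0) * (D - L) ≤ L - D + E + (R + p3 + p0 + 1) * G := by
    set b := (V k).re + p3 - p0 with hbd
    have hVre : |(V k).re| ≤ R := (Complex.abs_re_le_norm _).trans (hV k)
    have hb1 : b + 1 ≤ R + p3 + p0 + 1 := by
      have := (abs_le.mp hVre).2; linarith
    have hpos : 0 ≤ (R + p3 + p0 + 1) * G := by positivity
    have : (b+1) * (D - L) ≤ E + (R + p3 + p0 + 1) * G := by
      rcases le_total L D with h | h
      · have h1 : (b+1) * (D - L) ≤ (R + p3 + p0 + 1) * (D - L) := by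
          gcongr
        have h2 : (R + p3 + p0 + 1) * (D - L) ≤ (R + p3 + p0 + 1) * G := by
          gcongr; linarith
        linarith
      · have h0 : -(b+1) ≤ E / ((k:ℝ)+1) := by have := hb k; linarith
        have h1 : -(b+1) * (L - D) ≤ E / ((k:ℝ)+1) * (L - D) := by
          gcongr
        have h2 : E / ((k:ℝ)+1) * (L - D) ≤ E / ((k:ℝ)+1) * K := by
          gcongr; linarith
        linarith
    linarith
  have hLk := hL k
  have hLL : ((A k).re + (B k).re + (V k).re - (Y k).re - (Z k).re + σ0 + ((p1:ℝ)+p2+p3-p0-p4-p5)) * L = 0 := by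
    rw [hLk, zero_mul]
  linarith

lemma tannery (f : ℕ → ℕ → ℂ) (g : ℕ → ℂ) (p0 : ℕ) (hp0 : 1 ≤ p0) (a C : ℝ) (ha : 0 < a)
    (hf : ∀ n k : ℕ, k < n + p0 → ‖f n k‖ ≤ Real.exp (C + (-1-a) * Real.log ((k:ℝ)+1) + Real.log ((n:ℝ)+1) - Real.log (((n+p0-k:ℕ):ℝ)+1)))
    (hlim : ∀ k, Tendsto (fun n => f n k) atTop (𝓝 (g k))) :
    ∃ S : ℂ, Tendsto (fun N => ∑ k ∈ Finset.range N, g k) atTop (𝓝 S) ∧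
      Tendsto (fun n => ∑ k ∈ Finset.range (n + p0), f n k) atTop (𝓝 S) := by
  have hsum : ∀ b : ℝ, 0 < b → ∀ D : ℝ, Summable (fun k : ℕ => Real.exp (D + (-1-b) * Real.log ((k:ℝ)+1))) := by
    intro b hb D
    have h1 := (Real.summable_one_div_nat_add_rpow 1 (1+b)).mpr (by linarith)
    refine (h1.mul_left (Real.exp D)).congr (fun k => ?_)
    have hk : (0:ℝ) < (k:ℝ)+1 := by positivity
    rw [Real.exp_add, abs_of_pos hk, Real.rpow_def_of_pos hk, one_div, ← Real.exp_neg]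
    congr 2; ring
  have hfb : ∀ n k : ℕ, 2 * k ≤ n → ‖f n k‖ ≤ Real.exp ((C + Real.log 2) + (-1-a) * Real.log ((k:ℝ)+1)) := by
    intro n k hk
    refine (hf n k (by omega)).trans ?_
    rw [Real.exp_le_exp]
    have : Real.log ((n:ℝ)+1) ≤ Real.log (((n+p0-k:ℕ):ℝ)+1) + Real.log 2 := by
      apply log_cmp _ _ _ (by positivity) (by positivity) (by positivity)
      have : n + 1 ≤ 2 * ((n + p0 - k) + 1) := by omega
      exact_mod_cast this
    linarith
  have hS := hsum a ha (C + Real.log 2)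
  have hgb : ∀ k, ‖g k‖ ≤ Real.exp ((C + Real.log 2) + (-1-a) * Real.log ((k:ℝ)+1)) := by
    intro k
    refine le_of_tendsto (hlim k).norm ?_
    filter_upwards [eventually_ge_atTop (2*k)] with n hn
    exact hfb n k hn
  have hg : Summable g := Summable.of_norm_bounded hS hgb
  refine ⟨∑' k, g k, hg.hasSum.tendsto_sum_nat, ?_⟩
  set F1 : ℕ → ℕ → ℂ := fun n k => if 2 * k ≤ n then f n k else 0 with hF1
  set F2 : ℕ → ℕ → ℂ := fun n k => if 2 * k ≤ n then 0 else f n k with hF2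
  have hsplit : ∀ n, ∑ k ∈ Finset.range (n + p0), f n k
      = (∑' k, F1 n k) + ∑ k ∈ Finset.range (n + p0), F2 n k := by
    intro n
    rw [tsum_eq_sum (s := Finset.range (n + p0)), ← Finset.sum_add_distrib]
    · refine Finset.sum_congr rfl (fun k _ => ?_)
      simp only [hF1, hF2]; split_ifs <;> simp
    · intro k hk
      rw [Finset.mem_range] at hk
      simp only [hF1]; rw [if_neg (by omega)]
  have hT1 : Tendsto (fun n => ∑' k, F1 n k) atTop (𝓝 (∑' k, g k)) := by
    refine tendsto_tsum_of_dominated_convergence hS ?_ ?_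
    · intro k
      refine (hlim k).congr' ?_
      filter_upwards [eventually_ge_atTop (2*k)] with n hn
      simp [hF1, hn]
    · refine Eventually.of_forall (fun n k => ?_)
      simp only [hF1]; split_ifs with h
      · exact hfb n k h
      · simp; positivity
  obtain ⟨D, hD⟩ : ∃ D : ℝ, ∀ n k : ℕ, k < n + p0 → ‖F2 n k‖ ≤
      Real.exp (-(a/2) * Real.log ((n:ℝ)+1)) * Real.exp (D + (-1-a/2) * Real.log (((n+p0-1-k:ℕ):ℝ)+1)) := by
    refine ⟨C + (1+a) * Real.log 2 + (a/2) * Real.log ((p0:ℝ)+1), ?_⟩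
    intro n k hk
    simp only [hF2]; split_ifs with h
    · simp; positivity
    refine (hf n k hk).trans ?_
    rw [← Real.exp_add, Real.exp_le_exp]
    have h1 : Real.log ((n:ℝ)+1) ≤ Real.log ((k:ℝ)+1) + Real.log 2 := by
      apply log_cmp _ _ _ (by positivity) (by positivity) (by positivity)
      have : n + 1 ≤ 2 * (k + 1) := by omega
      exact_mod_cast this
    have h2 : Real.log (((n+p0-k:ℕ):ℝ)+1) ≤ Real.log ((n:ℝ)+1) + Real.log ((p0:ℝ)+1) := by
      apply log_cmp _ _ _ (by positivity) (by positivity) (by positivity)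
      have : (n+p0-k) + 1 ≤ (p0+1) * (n+1) := by
        have : (n+p0-k) ≤ n + p0 := by omega
        nlinarith
      exact_mod_cast this
    have h3 : Real.log (((n+p0-1-k:ℕ):ℝ)+1) ≤ Real.log (((n+p0-k:ℕ):ℝ)+1) := by
      apply Real.log_le_log (by positivity)
      have : n + p0 - 1 - k ≤ n + p0 - k := by omega
      have : ((n+p0-1-k:ℕ):ℝ) ≤ ((n+p0-k:ℕ):ℝ) := by exact_mod_cast this
      linarith
    set x := Real.log ((n:ℝ)+1)
    set y := Real.log ((k:ℝ)+1)
    set z := Real.log (((n+p0-k:ℕ):ℝ)+1)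
    set z' := Real.log (((n+p0-1-k:ℕ):ℝ)+1)
    have m1 : (1+a) * x ≤ (1+a) * (y + Real.log 2) := by gcongr
    have m2 : (a/2) * z ≤ (a/2) * (x + Real.log ((p0:ℝ)+1)) := by gcongr
    have m3 : (1+a/2) * z' ≤ (1+a/2) * z := by gcongr
    linarith
  have hT2 : Tendsto (fun n => ∑ k ∈ Finset.range (n + p0), F2 n k) atTop (𝓝 0) := by
    have hS2 := hsum (a/2) (by linarith) D
    refine squeeze_zero_norm (a := fun n : ℕ => Real.exp (-(a/2) * Real.log ((n:ℝ)+1)) *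
      ∑' k : ℕ, Real.exp (D + (-1-a/2) * Real.log ((k:ℝ)+1))) ?_ ?_
    · intro n
      refine (norm_sum_le _ _).trans ?_
      refine (Finset.sum_le_sum (fun k hk => hD n k (Finset.mem_range.mp hk))).trans ?_
      rw [← Finset.mul_sum]
      gcongr
      rw [Finset.sum_range_reflect (fun k : ℕ => Real.exp (D + (-1-a/2) * Real.log ((k:ℝ)+1)))]
      exact hS2.sum_le_tsum _ (fun _ _ => (Real.exp_pos _).le)
    · have : Tendsto (fun n : ℕ => Real.exp (-(a/2) * Real.log ((n:ℝ)+1))) atTop (𝓝 0) := by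
        apply Real.tendsto_exp_atBot.comp
        apply Tendsto.const_mul_atTop_of_neg (by linarith)
        apply Real.tendsto_log_atTop.comp
        exact tendsto_atTop_add_const_right _ _ tendsto_natCast_atTop_atTop
      simpa using this.mul_const _
  simpa [hsplit] using hT1.add hT2


lemma one_add_ne (n : ℕ) : ((n:ℂ)+1) ≠ 0 := by exact_mod_cast Nat.succ_ne_zero n

lemma ratio_lim (z : ℂ) (p : ℕ) : Tendsto (fun n : ℕ => (z + ((n + p : ℕ):ℂ)) / ((n:ℂ)+1)) atTop (𝓝 1) := by
  have h : Tendsto (fun n : ℕ => (1:ℂ) + (z + p - 1) * (1 / ((n:ℂ)+1))) atTop (𝓝 (1 + (z+p-1) * 0)) :=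
    (tendsto_one_div_add_atTop_nhds_zero_nat (𝕜 := ℂ)).const_mul _ |>.const_add _
  rw [mul_zero, add_zero] at h
  refine h.congr (fun n => ?_)
  have := one_add_ne n
  field_simp
  push_cast; ring

lemma cpow_ratio_lim (z : ℂ) : Tendsto (fun n : ℕ => (n:ℂ)^z / ((n:ℂ)+1)^z) atTop (𝓝 1) := by
  have h1 : Tendsto (fun n : ℕ => (((n:ℝ)/((n:ℝ)+1) : ℝ):ℂ)) atTop (𝓝 1) := by
    have := tendsto_natCast_div_add_atTop (𝕜 := ℝ) 1
    exact_mod_cast (Complex.continuous_ofReal.tendsto 1).comp this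
  have h2 : Tendsto (fun n : ℕ => (((n:ℝ)/((n:ℝ)+1) : ℝ):ℂ)^z) atTop (𝓝 ((1:ℂ)^z)) :=
    h1.cpow tendsto_const_nhds (by simp)
  rw [Complex.one_cpow] at h2
  refine h2.congr (fun n => ?_)
  have e : (((n:ℝ)/((n:ℝ)+1) : ℝ):ℂ) = ((n:ℝ):ℂ) * (((((n:ℝ)+1)⁻¹ : ℝ)):ℂ) := by push_cast; rw [div_eq_mul_inv]
  rw [e, Complex.mul_cpow_ofReal_nonneg (by positivity) (by positivity), div_eq_mul_inv]
  congr 1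
  have e2 : (((((n:ℝ)+1)⁻¹ : ℝ)):ℂ) = (((n:ℂ)+1))⁻¹ := by push_cast; rfl
  rw [e2, Complex.inv_cpow]
  have : ((n:ℂ)+1) = (((n+1:ℕ):ℝ):ℂ) := by push_cast; rfl
  rw [this, Complex.arg_ofReal_of_nonneg (by positivity)]
  exact Real.pi_pos.ne

lemma poch_lim (z : ℂ) (p : ℕ) (hp : 1 ≤ p) :
    Tendsto (fun n : ℕ => poch z (n+p) / ((n.factorial:ℂ) * ((n:ℂ)+1)^(z + p - 1))) atTop (𝓝 (Gamma z)⁻¹) := by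
  by_cases hz : ∃ m : ℕ, z = -m
  · obtain ⟨m, rfl⟩ := hz
    rw [(Complex.Gamma_eq_zero_iff _).mpr ⟨m, rfl⟩, inv_zero]
    refine tendsto_const_nhds.congr' ?_
    filter_upwards [eventually_gt_atTop m] with n hn
    have : poch (-(m:ℂ)) (n+p) = 0 := by
      unfold poch
      exact Finset.prod_eq_zero (i := m) (by simp; omega) (by simp)
    rw [this, zero_div]
  · have hG : Gamma z ≠ 0 := by
      rw [Ne, Complex.Gamma_eq_zero_iff]; exact hz
    induction p, hp using Nat.le_induction with
    | base =>
      have h1 := ((Complex.GammaSeq_tendsto_Gamma z).inv₀ hG).mul (cpow_ratio_lim z)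
      rw [mul_one] at h1
      refine h1.congr' ?_
      filter_upwards [eventually_gt_atTop 0] with n hn
      have hn' : (n:ℂ) ≠ 0 := by exact_mod_cast hn.ne'
      have h2 : (n:ℂ)^z ≠ 0 := by rw [Complex.cpow_ne_zero_iff]; left; exact hn'
      have h3 : ((n:ℂ)+1)^z ≠ 0 := by rw [Complex.cpow_ne_zero_iff]; left; exact one_add_ne n
      unfold Complex.GammaSeq poch
      have e : z + ((1:ℕ):ℂ) - 1 = z := by push_cast; ring
      rw [e, inv_div]
      field_simp
    | succ p hp ih =>
      have h1 := ih.mul (ratio_lim z p)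
      rw [mul_one] at h1
      refine h1.congr (fun n => ?_)
      have h0 := one_add_ne n
      have e : z + ((p+1:ℕ):ℂ) - 1 = (z + p - 1) + 1 := by push_cast; ring
      rw [e, Complex.cpow_add _ _ h0, Complex.cpow_one, ← add_assoc, poch_succ, div_mul_div_comm]
      ring_nf

lemma fact_lim (p0 k : ℕ) (hp : 1 ≤ p0) :
    Tendsto (fun n : ℕ => (n.factorial:ℂ) * ((n:ℂ)+1)^((p0:ℂ) - k) / ((n + p0 - k).factorial : ℂ)) atTop (𝓝 1) := by
  induction k with
  | zero =>
    have h := (poch_lim 1 p0 hp).inv₀ (by simp)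
    simp only [Complex.Gamma_one, inv_one] at h
    refine h.congr (fun n => ?_)
    have : poch 1 (n + p0) = ((n+p0).factorial : ℂ) := by
      induction (n+p0) with
      | zero => simp [poch]
      | succ m ih => rw [poch_succ, ih, Nat.factorial_succ]; push_cast; ring
    rw [this, inv_div]
    simp
  | succ k ih =>
    have h1 := ih.mul (ratio_lim (-k) p0)
    rw [mul_one] at h1
    refine h1.congr' ?_
    filter_upwards [eventually_gt_atTop k] with n hn
    have h0 := one_add_ne n
    have e : (p0:ℂ) - k = ((p0:ℂ) - ((k+1:ℕ):ℂ)) + 1 := by push_cast; ring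
    have e2 : n + p0 - k = (n + p0 - (k+1)) + 1 := by omega
    have e3 : -(k:ℂ) + ((n+p0:ℕ):ℂ) = (((n + p0 - (k+1)) + 1 : ℕ):ℂ) := by
      rw [← e2, Nat.cast_sub (by omega)]; ring
    rw [e, Complex.cpow_add _ _ h0, Complex.cpow_one, e2, e3, Nat.factorial_succ]
    have f1 : (((n + p0 - (k+1)) + 1 : ℕ):ℂ) ≠ 0 := by exact_mod_cast Nat.succ_ne_zero (n + p0 - (k+1))
    have f2 : (((n + p0 - (k+1)).factorial : ℕ):ℂ) ≠ 0 := by exact_mod_cast Nat.factorial_ne_zero (n + p0 - (k+1))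
    rw [Nat.cast_mul]
    field_simp

lemma Phi_lim (p0 p1 p2 p3 p4 p5 : ℕ) (h0 : 1 ≤ p0) (h1 : 1 ≤ p1) (h2 : 1 ≤ p2) (h3 : 1 ≤ p3) (h4 : 1 ≤ p4) (h5 : 1 ≤ p5)
    (hp : p1 + p2 + p3 = p0 + p4 + p5) (τ A B V Y Z : ℂ) (k : ℕ)
    (hτ : τ + A + B + V - Y - Z = 0) (hY : ∀ m : ℕ, Y ≠ -m) (hZ : ∀ m : ℕ, Z + k ≠ -m) :
    Tendsto (fun n : ℕ => ((n:ℂ)+1)^τ * Phi p0 p1 p2 p3 p4 p5 A B V Y Z n k) atTop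
      (𝓝 (1 / (k.factorial:ℂ) * (Gamma Y * Gamma (Z + k) / (Gamma (A + k) * Gamma B * Gamma (V - k))))) := by
  have lA := poch_lim (A + k) p1 h1
  have lB := poch_lim B p2 h2
  have lV := poch_lim (V - k) p3 h3
  have gY : (Gamma Y)⁻¹ ≠ 0 := inv_ne_zero (Complex.Gamma_ne_zero hY)
  have gZ : (Gamma (Z+k))⁻¹ ≠ 0 := inv_ne_zero (Complex.Gamma_ne_zero hZ)
  have lY := (poch_lim Y p4 h4)
  have lZ := (poch_lim (Z + k) p5 h5)
  have lF := fact_lim p0 (k+1) h0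
  have key := (((lA.mul lB).mul lV).div (lY.mul lZ) (mul_ne_zero gY gZ)).mul lF |>.const_mul (1 / (k.factorial:ℂ))
  have e : (1 / (k.factorial:ℂ)) * ((Gamma (A + k))⁻¹ * (Gamma B)⁻¹ * (Gamma (V - k))⁻¹ / ((Gamma Y)⁻¹ * (Gamma (Z + k))⁻¹) * 1)
      = (1 / (k.factorial:ℂ) * (Gamma Y * Gamma (Z + k) / (Gamma (A + k) * Gamma B * Gamma (V - k)))) := by
    simp only [div_eq_mul_inv, mul_inv, inv_inv]; ring
  rw [e] at key
  refine key.congr (fun n => ?_)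
  simp only [Pi.div_apply]
  unfold Phi
  have n0 := one_add_ne n
  have hpc : (p1:ℂ) + p2 + p3 = p0 + p4 + p5 := by exact_mod_cast hp
  have hpow : ((n:ℂ)+1)^τ * ((n:ℂ)+1)^(A + k + p1 - 1) * ((n:ℂ)+1)^(B + p2 - 1) * ((n:ℂ)+1)^(V - k + p3 - 1)
      = ((n:ℂ)+1)^(Y + p4 - 1) * ((n:ℂ)+1)^(Z + k + p5 - 1) * ((n:ℂ)+1)^((p0:ℂ) - ((k+1:ℕ):ℂ)) := by
    simp only [← Complex.cpow_add _ _ n0]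
    congr 1
    push_cast
    linear_combination hτ + hpc
  have hne : ∀ x : ℂ, ((n:ℂ)+1)^x ≠ 0 := fun x => by rw [Complex.cpow_ne_zero_iff]; left; exact n0
  have efac : n + p0 - (k+1) = n + p0 - 1 - k := by omega
  rw [efac]
  have a1 := hne (A + k + p1 - 1)
  have a2 := hne (B + p2 - 1)
  have a3 := hne (V - k + p3 - 1)
  have a4 := hne (Y + p4 - 1)
  have a5 := hne (Z + k + p5 - 1)
  have a6 := hne ((p0:ℂ) - ((k+1:ℕ):ℂ))
  have a7 := hne τ
  generalize ((n:ℂ)+1)^(A + k + p1 - 1) = x1 at *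
  generalize ((n:ℂ)+1)^(B + p2 - 1) = x2 at *
  generalize ((n:ℂ)+1)^(V - k + p3 - 1) = x3 at *
  generalize ((n:ℂ)+1)^(Y + p4 - 1) = x4 at *
  generalize ((n:ℂ)+1)^(Z + k + p5 - 1) = x5 at *
  generalize ((n:ℂ)+1)^((p0:ℂ) - ((k+1:ℕ):ℂ)) = x6 at *
  generalize ((n:ℂ)+1)^τ = x0 at *
  generalize poch (A + k) (n + p1) = q1
  generalize poch B (n + p2) = q2
  generalize poch (V - k) (n + p3) = q3
  generalize poch Y (n + p4) = q4
  generalize poch (Z + k) (n + p5) = q5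
  have b1 : (n.factorial:ℂ) ≠ 0 := by exact_mod_cast Nat.factorial_ne_zero n
  have b2 : (k.factorial:ℂ) ≠ 0 := by exact_mod_cast Nat.factorial_ne_zero k
  have b3 : ((n + p0 - 1 - k).factorial:ℂ) ≠ 0 := by exact_mod_cast Nat.factorial_ne_zero _
  generalize (n.factorial:ℂ) = f1 at *
  generalize (k.factorial:ℂ) = f2 at *
  generalize ((n + p0 - 1 - k).factorial:ℂ) = f3 at *
  have hx6 : x6 = x0 * x1 * x2 * x3 / (x4 * x5) := by
    rw [eq_div_iff (mul_ne_zero a4 a5)]; linear_combination -hpow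
  rw [hx6]
  simp only [div_eq_mul_inv, mul_inv, inv_inv]
  field_simp


lemma unif_lower (F : ℕ → ℕ → ℝ) (h : ∀ k, ∃ δ : ℝ, 0 < δ ∧ ∀ j, δ ≤ F k j) (N : ℕ)
    (hev : ∃ δ : ℝ, 0 < δ ∧ ∀ k, N ≤ k → ∀ j, δ ≤ F k j) : ∃ δ : ℝ, 0 < δ ∧ ∀ k j, δ ≤ F k j := by
  induction N with
  | zero =>
    obtain ⟨δ, h0, h1⟩ := hev
    exact ⟨δ, h0, fun k j => h1 k (Nat.zero_le _) j⟩
  | succ N ih =>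
    apply ih
    obtain ⟨δ, h0, h1⟩ := hev
    obtain ⟨δ', h0', h1'⟩ := h N
    refine ⟨min δ δ', lt_min h0 h0', fun k hk j => ?_⟩
    rcases Nat.eq_or_lt_of_le hk with h2 | h2
    · subst h2; exact (min_le_right _ _).trans (h1' j)
    · exact (min_le_left _ _).trans (h1 k h2 j)

lemma norm_add_nat_ge (z : ℂ) (k : ℕ) : (k:ℝ) - ‖z‖ ≤ ‖z + k‖ := by
  have h := norm_sub_le (z + k) z
  have e : z + (k:ℂ) - z = k := by ring
  rw [e, Complex.norm_natCast] at h
  linarith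

lemma pos_seq (z : ℂ) (hz : ∀ m : ℕ, z ≠ -(m:ℂ)) : ∃ δ : ℝ, 0 < δ ∧ ∀ j : ℕ, δ ≤ ‖z + j‖ := by
  obtain ⟨N, hN⟩ := exists_nat_ge (‖z‖ + 1)
  obtain ⟨δ, h0, h1⟩ := unif_lower (fun k _ => ‖z + k‖) (fun k => ⟨‖z + k‖, norm_pos_iff.mpr (fun h => hz k (eq_neg_of_add_eq_zero_left h)), fun _ => le_rfl⟩) N
    ⟨1, one_pos, fun k hk _ => by
      have := norm_add_nat_ge z k
      have h2 : (N:ℝ) ≤ k := by exact_mod_cast hk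
      linarith⟩
  exact ⟨δ, h0, fun j => h1 j 0⟩

lemma inv_decay (z : ℂ) (hz : ∀ m : ℕ, z ≠ -(m:ℂ)) : ∃ C : ℝ, 0 ≤ C ∧ ∀ k : ℕ, ‖1 / (z + k)‖ ≤ C / ((k:ℝ)+1) := by
  obtain ⟨δ, h0, h1⟩ := pos_seq z hz
  refine ⟨1 + (‖z‖ + 1) / δ, by positivity, fun k => ?_⟩
  have hk := h1 k
  have hp : 0 < ‖z + k‖ := h0.trans_le hk
  rw [norm_div, norm_one, div_le_div_iff₀ hp (by positivity)]
  have h2 := norm_add_nat_ge z k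
  have h3 : (‖z‖ + 1) ≤ (‖z‖+1)/δ * ‖z + k‖ := by
    rw [div_mul_eq_mul_div, le_div_iff₀ h0]
    gcongr
  linarith

lemma decay_c (d d' e g : ℂ) (k : ℕ) (h1 : d * d' = e) (h2 : d + d' = g + k) (h3 : ‖d‖ ≤ ‖d'‖) :
    ‖d‖ ≤ (2 * ‖e‖ + (‖e‖ + 1) * (‖g‖ + 1)) / ((k:ℝ)+1) := by
  rw [le_div_iff₀ (by positivity)]
  have a1 : ‖d‖ * ‖d'‖ = ‖e‖ := by rw [← norm_mul, h1]
  have a2 : ‖d‖ ≤ ‖e‖ + 1 := by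
    have : ‖d‖ * ‖d‖ ≤ ‖e‖ := by rw [← a1]; gcongr
    nlinarith [sq_nonneg (‖d‖ - 1), norm_nonneg e, norm_nonneg d]
  have a3 : (k:ℝ) - ‖g‖ ≤ 2 * ‖d'‖ := by
    have := norm_add_nat_ge g k
    rw [← h2] at this
    have := norm_add_le d d'
    linarith
  have b1 : ‖d‖ * ((k:ℝ)+1) ≤ ‖d‖ * (2 * ‖d'‖ + (‖g‖ + 1)) :=
    mul_le_mul_of_nonneg_left (by linarith) (norm_nonneg d)
  have b2 : ‖d‖ * (‖g‖+1) ≤ (‖e‖+1) * (‖g‖+1) := by gcongr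
  nlinarith

lemma norm_S (n : ℕ) (τ : ℂ) : ‖((n:ℂ)+1)^τ‖ = Real.exp (τ.re * Real.log ((n:ℝ)+1)) := by
  have : ((n:ℂ)+1) = (((n:ℝ)+1 : ℝ):ℂ) := by push_cast; rfl
  rw [this, Complex.norm_cpow_eq_rpow_re_of_pos (by positivity), Real.rpow_def_of_pos (by positivity), mul_comm]

lemma series_lim (p0 p1 p2 p3 p4 p5 : ℕ) (h0 : 1 ≤ p0) (h1 : 1 ≤ p1) (h2 : 1 ≤ p2) (h3 : 1 ≤ p3) (h4 : 1 ≤ p4) (h5 : 1 ≤ p5)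
    (hp : p1 + p2 + p3 = p0 + p4 + p5) (τ A t v s lam : ℂ) (Y w : ℕ → ℂ) (C W : ℝ)
    (hτ : τ + A + t + v - s = 0) (ha : 0 < (A + v - s + 2 * lam).re)
    (hlam : ∀ m : ℕ, lam ≠ -(m:ℂ)) (hC : 0 ≤ C) (hY : ∀ k : ℕ, ‖Y k - lam‖ ≤ C / ((k:ℝ)+1))
    (hYn : ∀ k m : ℕ, Y k ≠ -(m:ℂ)) (hZn : ∀ k m : ℕ, s - Y k + k ≠ -(m:ℂ))
    (hw : ∀ k : ℕ, ‖w k‖ ≤ W / ((k:ℝ)+1))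
    (hb : -1 ≤ (v + lam).re + p3 - p0) :
    ∃ S : ℂ, Tendsto (fun N => ∑ k ∈ Finset.range N, ((-1:ℂ)^k / (k.factorial:ℂ))
        * (Gamma (Y k) * Gamma (s - Y k + k) / (Gamma (A + k) * Gamma (t - Y k) * Gamma (v + Y k - k))) * w k) atTop (𝓝 S) ∧
      Tendsto (fun n : ℕ => ∑ k ∈ Finset.range (n + p0),
        ((n:ℂ)+1)^τ * ((-1:ℂ)^k * Phi p0 p1 p2 p3 p4 p5 A (t - Y k) (v + Y k) (Y k) (s - Y k) n k * w k)) atTop (𝓝 S) := by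
  have hk1 : ∀ k : ℕ, (1:ℝ) ≤ (k:ℝ)+1 := fun k => by linarith [(Nat.cast_nonneg k : (0:ℝ) ≤ k)]
  have hYb : ∀ k : ℕ, ‖Y k‖ ≤ ‖lam‖ + C := by
    intro k
    have a1 : C / ((k:ℝ)+1) ≤ C := div_le_self hC (hk1 k)
    have a2 : ‖Y k‖ ≤ ‖Y k - lam‖ + ‖lam‖ := by
      have := norm_add_le (Y k - lam) lam
      simpa using this
    linarith [hY k]
  set R := ‖A‖ + ‖t‖ + ‖v‖ + ‖s‖ + (‖lam‖ + C) with hRd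
  have nA := norm_nonneg A
  have nt := norm_nonneg t
  have nv := norm_nonneg v
  have ns := norm_nonneg s
  have nl := norm_nonneg lam
  have hR : 0 ≤ R := by positivity
  have hZb : ∀ k, ‖s - Y k‖ ≤ R := fun k => (norm_sub_le _ _).trans (by linarith [hYb k])
  obtain ⟨δ1, hδ1, hd1⟩ : ∃ δ : ℝ, 0 < δ ∧ ∀ k j : ℕ, δ ≤ ‖Y k + j‖ := by
    obtain ⟨δ, hδ, hd⟩ := pos_seq lam hlam
    obtain ⟨N, hN⟩ := exists_nat_ge (C / (δ/2))
    refine unif_lower (fun k j => ‖Y k + j‖) (fun k => pos_seq _ (hYn k)) N ⟨δ/2, by positivity, fun k hk j => ?_⟩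
    have h2 : (N:ℝ) ≤ k := by exact_mod_cast hk
    have a1 : C / ((k:ℝ)+1) ≤ δ/2 := by
      rw [div_le_iff₀ (by positivity)]
      rw [div_le_iff₀ (by positivity)] at hN
      nlinarith
    have a2 : ‖lam + j‖ ≤ ‖Y k + j‖ + ‖Y k - lam‖ := by
      have := norm_sub_le (Y k + j) (Y k - lam)
      have e : Y k + j - (Y k - lam) = lam + j := by ring
      rwa [e] at this
    have := hd j
    have := hY k
    show δ/2 ≤ ‖Y k + j‖
    linarith
  obtain ⟨δ2, hδ2, hd2⟩ : ∃ δ : ℝ, 0 < δ ∧ ∀ k j : ℕ, δ ≤ ‖s - Y k + k + j‖ := by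
    obtain ⟨N, hN⟩ := exists_nat_ge (R + 1)
    refine unif_lower (fun k j => ‖s - Y k + k + j‖) (fun k => pos_seq _ (hZn k)) N ⟨1, one_pos, fun k hk j => ?_⟩
    have h2 : (N:ℝ) ≤ k := by exact_mod_cast hk
    have a1 := norm_add_nat_ge (s - Y k) (k + j)
    have a2 := hZb k
    have e : s - Y k + ((k+j:ℕ):ℂ) = s - Y k + k + j := by push_cast; ring
    rw [e] at a1
    push_cast at a1
    have : (0:ℝ) ≤ j := by positivity
    show 1 ≤ ‖s - Y k + k + j‖
    linarith
  have hτ' := congrArg Complex.re hτ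
  simp only [Complex.add_re, Complex.sub_re, Complex.zero_re] at hτ'
  have hpr : (p1:ℝ) + p2 + p3 = p0 + p4 + p5 := by exact_mod_cast hp
  have hre : ∀ k : ℕ, |(Y k).re - lam.re| ≤ C / ((k:ℝ)+1) := fun k => by
    rw [← Complex.sub_re]; exact (Complex.abs_re_le_norm _).trans (hY k)
  simp only [Complex.add_re, Complex.sub_re, Complex.mul_re, Complex.re_ofNat, Complex.im_ofNat, zero_mul, sub_zero] at ha hb
  obtain ⟨K, hK⟩ := Phi_bound p0 p1 p2 p3 p4 p5 τ.re (A.re + v.re - s.re + 2 * lam.re) R (min δ1 δ2) (2 * C) W hR (lt_min hδ1 hδ2)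
    (by positivity) (fun _ => A) (fun k => t - Y k) (fun k => v + Y k) Y (fun k => s - Y k) w
    (fun k => by linarith) (fun k => (norm_sub_le _ _).trans (by linarith [hYb k])) (fun k => (norm_add_le _ _).trans (by linarith [hYb k]))
    (fun k => by linarith [hYb k]) hZb (fun k j => (min_le_left _ _).trans (hd1 k j)) (fun k j => (min_le_right _ _).trans (hd2 k j)) hw
    (fun k => by simp only [Complex.add_re, Complex.sub_re]; linarith)
    (fun k => by
      simp only [Complex.add_re, Complex.sub_re]
      have e : A.re + (v.re + (Y k).re) - (s.re - (Y k).re) - (A.re + v.re - s.re + 2 * lam.re) = 2 * ((Y k).re - lam.re) := by ring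
      rw [e, abs_mul, abs_two, mul_div_assoc]
      linarith [hre k])
    (fun k => by
      simp only [Complex.add_re]
      have := (abs_le.mp (hre k)).1
      have e : 2 * C / ((k:ℝ)+1) = C / ((k:ℝ)+1) + C / ((k:ℝ)+1) := by ring
      have : 0 ≤ C / ((k:ℝ)+1) := by positivity
      linarith)
  refine tannery (fun n k => ((n:ℂ)+1)^τ * ((-1:ℂ)^k * Phi p0 p1 p2 p3 p4 p5 A (t - Y k) (v + Y k) (Y k) (s - Y k) n k * w k)) _ p0 h0 _ K ha ?_ ?_
  · intro n k hk
    refine le_trans (le_of_eq ?_) (hK n k hk)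
    simp only [norm_mul, norm_S, norm_pow, norm_neg, norm_one, one_pow, one_mul]
    ring
  · intro k
    have := (Phi_lim p0 p1 p2 p3 p4 p5 h0 h1 h2 h3 h4 h5 hp τ A (t - Y k) (v + Y k) (Y k) (s - Y k) k
      (by linear_combination hτ) (hYn k) (hZn k)).const_mul ((-1:ℂ)^k * w k)
    refine (this.congr (fun n => ?_)).trans (le_of_eq ?_)
    · ring
    · congr 1; ring

lemma prod_lt_fac (k : ℕ) : ∏ j ∈ Finset.range k, ((j:ℂ) - k) = (-1)^k * (k.factorial : ℂ) := by
  rw [← Finset.prod_range_reflect, ← Finset.prod_range_add_one_eq_factorial]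
  push_cast
  rw [← Finset.card_range k, ← Finset.prod_const, Finset.card_range, ← Finset.prod_mul_distrib]
  refine Finset.prod_congr rfl (fun j hj => ?_)
  rw [Finset.mem_range] at hj
  have : k - 1 - j = k - (j + 1) := by omega
  rw [this, Nat.cast_sub (by omega)]
  push_cast; ring

lemma prod_erase_fac (K k : ℕ) (hk : k + 1 ≤ K) :
    ∏ j ∈ (Finset.range K).erase k, ((j:ℂ) - k) = (-1)^k * ((k.factorial : ℂ) * ((K-1-k).factorial : ℂ)) := by
  induction K, hk using Nat.le_induction with
  | base =>
    rw [Finset.range_add_one, Finset.erase_insert (by simp), prod_lt_fac]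
    simp
  | succ K hk ih =>
    rw [Finset.range_add_one, Finset.erase_insert_of_ne (by omega), Finset.prod_insert (by simp), ih]
    have e : K + 1 - 1 - k = (K - 1 - k) + 1 := by omega
    have e2 : (K:ℂ) - k = (((K-1-k) + 1 : ℕ) : ℂ) := by
      rw [← e, Nat.cast_sub (by omega)]; push_cast; ring
    rw [e, Nat.factorial_succ, Nat.cast_mul, e2]
    ring

lemma poch_erase (y : ℂ) (K k : ℕ) (hk : k < K) (hy : y + k ≠ 0) :
    ∏ j ∈ (Finset.range K).erase k, (y + j) = poch y K / (y + k) := by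
  rw [eq_div_iff hy]
  unfold poch
  rw [mul_comm, Finset.mul_prod_erase _ (fun j : ℕ => y + (j:ℂ)) (Finset.mem_range.mpr hk)]

lemma erase_inl (S T : Finset ℕ) (k : ℕ) : (S.disjSum T).erase (Sum.inl k) = (S.erase k).disjSum T := by
  ext x; cases x <;> simp

lemma erase_inr (S T : Finset ℕ) (k : ℕ) : (S.disjSum T).erase (Sum.inr k) = S.disjSum (T.erase k) := by
  ext x; cases x <;> simp

lemma neg_one_pow_inv (k : ℕ) : ((-1:ℂ)^k)⁻¹ = (-1)^k := by
  rw [← inv_pow]; norm_num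

lemma poch_ne (z : ℂ) (m : ℕ) (hz : ∀ j : ℕ, z ≠ -(j:ℂ)) : poch z m ≠ 0 := by
  unfold poch
  exact Finset.prod_ne_zero_iff.mpr (fun j _ h => hz j (eq_neg_of_add_eq_zero_left h))

lemma finite_id (s t u lam x₁ x₂ : ℂ) (y c : ℕ → ℂ) (n p q : ℕ)
    (hy : ∀ k : ℕ, y k = lam - (lam - x₁) * (lam - x₂) / (lam + k))
    (hc : ∀ k : ℕ, c k * (s + k - c k) = x₁ * x₂ + (s + k - x₁ - x₂) * lam)
    (hx₁ : ∀ m : ℕ, x₁ ≠ -(m : ℂ))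
    (hx₂ : ∀ m : ℕ, x₂ ≠ -(m : ℂ))
    (hlam : ∀ m : ℕ, lam ≠ -(m : ℂ))
    (hsx : ∀ k : ℕ, s - x₁ - x₂ + k ≠ 0)
    (heps₁ : ∀ k : ℕ, ∀ m : ℕ, y k ≠ -(m : ℂ))
    (heps₂ : ∀ k : ℕ, ∀ m : ℕ, s - y k + k ≠ -(m : ℂ)) :
    poch (t - x₁) (n+p) * poch (t - x₂) (n+p) * poch (u + x₁ + x₂) (n+q)
        / (poch x₁ (n+p) * poch x₂ (n+p) * poch (s - x₁ - x₂) (n+q))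
      = (∏ j ∈ Finset.range (n+p), (lam - t - j)) / (poch lam (n+p) * (-1)^(n+q))
        + ∑ k ∈ Finset.range (n+p), ((-1:ℂ)^k * Phi p p p q p q t (t - y k) (u + y k) (y k) (s - y k) n k
            * (1 / (x₁ + k) + 1 / (x₂ + k) - 1 / (lam + k)))
        + ∑ k ∈ Finset.range (n+q), ((-1:ℂ)^k * Phi q q p p p p (u + s) (t - c k) (t - s + c k) (c k) (s - c k) n k
            * (1 / (s + k - x₁ - x₂))) := by
  have hne : ∀ (z : ℂ), (∀ m : ℕ, z ≠ -(m:ℂ)) → ∀ k : ℕ, z + k ≠ 0 :=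
    fun z hz k h => hz k (eq_neg_of_add_eq_zero_left h)
  have hy2 : ∀ k : ℕ, y k * (lam + k) = lam * (lam + k) - (lam - x₁) * (lam - x₂) := by
    intro k
    have := hne lam hlam k
    rw [hy k]; field_simp
  set Q := x₁ * x₂ - lam * (x₁ + x₂) with hQ
  have main := pf_aux ((Finset.range (n+p)).disjSum (Finset.range (n+q)))
    (Sum.elim (fun j : ℕ => lam - t - j) (fun _ : ℕ => (1:ℂ)))
    (Sum.elim (fun j : ℕ => (t + j)^2 + Q) (fun j : ℕ => u + j))
    (Sum.elim (fun j : ℕ => lam + j) (fun _ : ℕ => (-1:ℂ)))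
    (Sum.elim (fun j : ℕ => Q + (j:ℂ)^2) (fun j : ℕ => s + j))
    (Sum.elim (fun k : ℕ => y k - k) (fun k : ℕ => s + k)) (x₁ + x₂)
    (by
      rintro (i | i) _
      · exact hne lam hlam i
      · simp)
    (by
      rintro (i | i) _
      · simp only [Sum.elim_inl]; linear_combination hy2 i
      · simp only [Sum.elim_inr]; ring)
    (by
      have hll : ∀ i j : ℕ, y i - i = y j - j → i = j := by
        intro i j h
        have h1 : (y i + j) * ((j:ℂ) - i) = 0 := by
          linear_combination (lam + j) * h + hy2 j - hy2 i
        rcases mul_eq_zero.mp h1 with h2 | h2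
        · exact absurd h2 (hne _ (heps₁ i) j)
        · exact_mod_cast (sub_eq_zero.mp h2).symm
      rintro (i | i) _ (j | j) _ h
      · simp only [Sum.elim_inl] at h; rw [hll i j h]
      · simp only [Sum.elim_inl, Sum.elim_inr] at h
        exact absurd (by linear_combination -h) (heps₂ i j)
      · simp only [Sum.elim_inl, Sum.elim_inr] at h
        exact absurd (by linear_combination h) (heps₂ j i)
      · simp only [Sum.elim_inr] at h
        have : i = j := by exact_mod_cast add_left_cancel h
        rw [this])
    (by
      rintro (i | i) _
      · simp only [Sum.elim_inl]
        have : (lam + i) * (x₁ + x₂) + (Q + (i:ℂ)^2) = (x₁ + i) * (x₂ + i) := by rw [hQ]; ring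
        rw [this]
        exact mul_ne_zero (hne _ hx₁ i) (hne _ hx₂ i)
      · simp only [Sum.elim_inr]
        intro h; exact hsx i (by linear_combination h))
  rw [Finset.sum_disjSum] at main
  simp only [erase_inl, erase_inr, Finset.prod_disjSum, Sum.elim_inl, Sum.elim_inr, Finset.prod_const, Finset.card_range, one_pow, mul_one] at main
  have eL : ∀ σ y1 y2 : ℂ, σ = y1 + y2 → y1 * y2 = lam * σ + Q → ∀ j : ℕ, (lam + j) * σ + (Q + (j:ℂ)^2) = (y1 + j) * (y2 + j) := by
    intro σ y1 y2 h1 h2 j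
    linear_combination (j:ℂ) * h1 - h2
  have eT : ∀ σ y1 y2 : ℂ, σ = y1 + y2 → y1 * y2 = lam * σ + Q → ∀ j : ℕ, (lam - t - j) * σ + ((t + j)^2 + Q) = (t - y1 + j) * (t - y2 + j) := by
    intro σ y1 y2 h1 h2 j
    linear_combination -(t + j) * h1 - h2
  -- left side
  have hxx : x₁ * x₂ = lam * (x₁ + x₂) + Q := by rw [hQ]; ring
  have l1 : ∏ j ∈ Finset.range (n+p), ((lam - t - j) * (x₁ + x₂) + ((t + j)^2 + Q)) = poch (t - x₁) (n+p) * poch (t - x₂) (n+p) := by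
    unfold poch; rw [← Finset.prod_mul_distrib]
    exact Finset.prod_congr rfl (fun j _ => eT _ _ _ rfl hxx j)
  have l2 : ∏ j ∈ Finset.range (n+q), (1 * (x₁ + x₂) + (u + j)) = poch (u + x₁ + x₂) (n+q) := by
    unfold poch; exact Finset.prod_congr rfl (fun j _ => by ring)
  have l3 : ∏ j ∈ Finset.range (n+p), ((lam + j) * (x₁ + x₂) + (Q + (j:ℂ)^2)) = poch x₁ (n+p) * poch x₂ (n+p) := by
    unfold poch; rw [← Finset.prod_mul_distrib]
    exact Finset.prod_congr rfl (fun j _ => eL _ _ _ rfl hxx j)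
  have l4 : ∏ j ∈ Finset.range (n+q), (-1 * (x₁ + x₂) + (s + j)) = poch (s - x₁ - x₂) (n+q) := by
    unfold poch; exact Finset.prod_congr rfl (fun j _ => by ring)
  rw [l1, l2, l3, l4] at main
  rw [main, ← add_assoc]
  congr 1
  · congr 1
    refine Finset.sum_congr rfl (fun k hk => ?_)
    rw [Finset.mem_range] at hk
    have hyy : y k * (-(k:ℂ)) = lam * (y k - k) + Q := by rw [hQ]; linear_combination -hy2 k
    have r1 : ∏ j ∈ Finset.range (n+p), ((lam - t - j) * (y k - k) + ((t + j)^2 + Q)) = poch (t - y k) (n+p) * poch (t + k) (n+p) := by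
      unfold poch; rw [← Finset.prod_mul_distrib]
      refine Finset.prod_congr rfl (fun j _ => ?_)
      rw [eT _ (y k) (-k) (by ring) hyy j]; ring
    have r2 : ∏ j ∈ Finset.range (n+q), (1 * (y k - k) + (u + j)) = poch (u + y k - k) (n+q) := by
      unfold poch; exact Finset.prod_congr rfl (fun j _ => by ring)
    have r3 : ∏ j ∈ (Finset.range (n+p)).erase k, ((lam + j) * (y k - k) + (Q + (j:ℂ)^2))
        = (poch (y k) (n+p) / (y k + k)) * ((-1)^k * ((k.factorial : ℂ) * ((n+p-1-k).factorial : ℂ))) := by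
      rw [← poch_erase _ _ _ hk (hne _ (heps₁ k) k), ← prod_erase_fac _ _ hk, ← Finset.prod_mul_distrib]
      refine Finset.prod_congr rfl (fun j _ => ?_)
      rw [eL _ (y k) (-k) (by ring) hyy j]; ring
    have r4 : ∏ j ∈ Finset.range (n+q), (-1 * (y k - k) + (s + j)) = poch (s - y k + k) (n+q) := by
      unfold poch; exact Finset.prod_congr rfl (fun j _ => by ring)
    rw [r1, r2, r3, r4, eL _ x₁ x₂ rfl hxx k]
    have w : 1 / (x₁ + k) + 1 / (x₂ + k) - 1 / (lam + k) = (y k + k) / ((x₁ + k) * (x₂ + k)) := by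
      have a1 := hne _ hx₁ k
      have a2 := hne _ hx₂ k
      have a3 := hne _ hlam k
      rw [eq_div_iff (mul_ne_zero a1 a2)]
      field_simp
      linear_combination -hy2 k
    rw [w]
    unfold Phi
    simp only [div_eq_mul_inv, mul_inv, inv_inv, neg_one_pow_inv]
    ring
  · refine Finset.sum_congr rfl (fun k hk => ?_)
    rw [Finset.mem_range] at hk
    have hcc : c k * (s + k - c k) = lam * (s + k) + Q := by rw [hQ]; linear_combination hc k
    have r1 : ∏ j ∈ Finset.range (n+p), ((lam - t - j) * (s + k) + ((t + j)^2 + Q)) = poch (t - c k) (n+p) * poch (t - s + c k - k) (n+p) := by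
      unfold poch; rw [← Finset.prod_mul_distrib]
      refine Finset.prod_congr rfl (fun j _ => ?_)
      rw [eT _ (c k) (s + k - c k) (by ring) hcc j]; ring
    have r2 : ∏ j ∈ Finset.range (n+q), (1 * (s + k) + (u + j)) = poch (u + s + k) (n+q) := by
      unfold poch; exact Finset.prod_congr rfl (fun j _ => by ring)
    have r3 : ∏ j ∈ Finset.range (n+p), ((lam + j) * (s + k) + (Q + (j:ℂ)^2)) = poch (c k) (n+p) * poch (s - c k + k) (n+p) := by
      unfold poch; rw [← Finset.prod_mul_distrib]
      refine Finset.prod_congr rfl (fun j _ => ?_)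
      rw [eL _ (c k) (s + k - c k) (by ring) hcc j]; ring
    have r4 : ∏ j ∈ (Finset.range (n+q)).erase k, (-1 * (s + k) + (s + j))
        = ((-1)^k * ((k.factorial : ℂ) * ((n+q-1-k).factorial : ℂ))) := by
      rw [← prod_erase_fac _ _ hk]
      exact Finset.prod_congr rfl (fun j _ => by ring)
    rw [r1, r2, r3, r4]
    have e : -1 * (x₁ + x₂) + (s + k) = s + k - x₁ - x₂ := by ring
    rw [e]
    unfold Phi
    simp only [div_eq_mul_inv, mul_inv, inv_inv, neg_one_pow_inv]
    ring

lemma cpow_neg_lim (z : ℂ) (hz : z.re < 0) : Tendsto (fun n : ℕ => ((n:ℂ)+1)^z) atTop (𝓝 0) := by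
  rw [tendsto_zero_iff_norm_tendsto_zero]
  simp only [norm_S]
  apply Real.tendsto_exp_atBot.comp
  apply Tendsto.const_mul_atTop_of_neg hz
  apply Real.tendsto_log_atTop.comp
  exact tendsto_atTop_add_const_right _ _ tendsto_natCast_atTop_atTop

lemma poch_ratio_lim (A B : ℂ) (p : ℕ) (hp : 1 ≤ p) (hB : ∀ m : ℕ, B ≠ -(m:ℂ)) :
    Tendsto (fun n : ℕ => ((n:ℂ)+1)^(B - A) * (poch A (n+p) / poch B (n+p))) atTop (𝓝 (Gamma B / Gamma A)) := by
  have gB : (Gamma B)⁻¹ ≠ 0 := inv_ne_zero (Complex.Gamma_ne_zero hB)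
  have key := (poch_lim A p hp).div (poch_lim B p hp) gB
  have e : (Gamma A)⁻¹ / (Gamma B)⁻¹ = Gamma B / Gamma A := by
    simp only [div_eq_mul_inv, inv_inv]; ring
  rw [e] at key
  refine key.congr (fun n => ?_)
  simp only [Pi.div_apply]
  have n0 := one_add_ne n
  have hne : ∀ x : ℂ, ((n:ℂ)+1)^x ≠ 0 := fun x => by rw [Complex.cpow_ne_zero_iff]; left; exact n0
  have hpow : ((n:ℂ)+1)^(B + p - 1) = ((n:ℂ)+1)^(B - A) * ((n:ℂ)+1)^(A + p - 1) := by
    rw [← Complex.cpow_add _ _ n0]; congr 1; ring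
  rw [hpow]
  have a1 := hne (B - A)
  have a2 := hne (A + p - 1)
  have a3 := poch_ne B (n+p) hB
  have b1 : (n.factorial:ℂ) ≠ 0 := by exact_mod_cast Nat.factorial_ne_zero n
  field_simp

lemma lhs_lim (p q : ℕ) (hp : 1 ≤ p) (hq : 1 ≤ q) (τ A B V X Y Z : ℂ) (hτ : τ + A + B + V - X - Y - Z = 0)
    (hX : ∀ m : ℕ, X ≠ -(m:ℂ)) (hY : ∀ m : ℕ, Y ≠ -(m:ℂ)) (hZ : ∀ m : ℕ, Z ≠ -(m:ℂ)) :
    Tendsto (fun n : ℕ => ((n:ℂ)+1)^τ * (poch A (n+p) * poch B (n+p) * poch V (n+q)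
        / (poch X (n+p) * poch Y (n+p) * poch Z (n+q)))) atTop
      (𝓝 (Gamma X * Gamma Y * Gamma Z / (Gamma A * Gamma B * Gamma V))) := by
  have key := ((poch_ratio_lim A X p hp hX).mul (poch_ratio_lim B Y p hp hY)).mul (poch_ratio_lim V Z q hq hZ)
  have e : Gamma X / Gamma A * (Gamma Y / Gamma B) * (Gamma Z / Gamma V)
      = Gamma X * Gamma Y * Gamma Z / (Gamma A * Gamma B * Gamma V) := by
    simp only [div_eq_mul_inv, mul_inv]; ring
  rw [e] at key
  refine key.congr (fun n => ?_)
  have n0 := one_add_ne n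
  have hpow : ((n:ℂ)+1)^τ = ((n:ℂ)+1)^(X - A) * ((n:ℂ)+1)^(Y - B) * ((n:ℂ)+1)^(Z - V) := by
    rw [← Complex.cpow_add _ _ n0, ← Complex.cpow_add _ _ n0]; congr 1; linear_combination hτ
  rw [hpow]
  simp only [div_eq_mul_inv, mul_inv]
  ring

lemma const_lim (p q : ℕ) (hp : 1 ≤ p) (τ t lam : ℂ) (ha : (τ + t - 2 * lam).re < 0)
    (hlam : ∀ m : ℕ, lam ≠ -(m:ℂ)) :
    Tendsto (fun n : ℕ => ((n:ℂ)+1)^τ * ((∏ j ∈ Finset.range (n+p), (lam - t - j)) / (poch lam (n+p) * (-1)^(n+q)))) atTop (𝓝 0) := by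
  have key := (cpow_neg_lim _ ha).mul (poch_ratio_lim (t - lam) lam p hp hlam)
  rw [zero_mul] at key
  rw [tendsto_zero_iff_norm_tendsto_zero] at key ⊢
  refine key.congr (fun n => ?_)
  have n0 := one_add_ne n
  have hpow : ((n:ℂ)+1)^τ = ((n:ℂ)+1)^(τ + t - 2 * lam) * ((n:ℂ)+1)^(lam - (t - lam)) := by
    rw [← Complex.cpow_add _ _ n0]; congr 1; ring
  have e : ‖∏ j ∈ Finset.range (n+p), (lam - t - (j:ℂ))‖ = ‖poch (t - lam) (n+p)‖ := by
    unfold poch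
    rw [norm_prod, norm_prod]
    refine Finset.prod_congr rfl (fun j _ => ?_)
    rw [← norm_neg]; congr 1; ring
  rw [hpow]
  simp only [norm_mul, norm_div, norm_pow, norm_neg, norm_one, one_pow, mul_one, e, mul_assoc]


/-- Corollary 4.1: asymmetric expansion of closed string amplitudes. -/
theorem closed_asymmetric_expansion (s t u lam x₁ x₂ : ℂ)
    (hre : 0 < (2 * lam - s + t + u).re)
    (cp cm : ℕ → ℂ)
    (hc : ∀ k : ℕ, cp k + cm k = s + k
      ∧ cp k * cm k = x₁ * x₂ + (s + k - x₁ - x₂) * lam)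
    (hx₁ : ∀ m : ℕ, x₁ ≠ -(m : ℂ))
    (hx₂ : ∀ m : ℕ, x₂ ≠ -(m : ℂ))
    (hlam : ∀ m : ℕ, lam ≠ -(m : ℂ))
    (hsx : ∀ k : ℕ, s - x₁ - x₂ + k ≠ 0)
    (heps₁ : ∀ k : ℕ, ∀ m : ℕ,
      lam - (lam - x₁) * (lam - x₂) / (lam + k) ≠ -(m : ℂ))
    (heps₂ : ∀ k : ℕ, ∀ m : ℕ,
      s - lam + (lam - x₁) * (lam - x₂) / (lam + k) + k ≠ -(m : ℂ))
    (hcp : ∀ k : ℕ, ∀ m : ℕ, cp k ≠ -(m : ℂ))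
    (hcm : ∀ k : ℕ, ∀ m : ℕ, cm k ≠ -(m : ℂ))
    (hs' : ∀ m : ℕ, s - x₁ - x₂ ≠ -(m : ℂ))
    (ht₁ : ∀ m : ℕ, t - x₁ ≠ -(m : ℂ))
    (ht₂ : ∀ m : ℕ, t - x₂ ≠ -(m : ℂ))
    (hu : ∀ m : ℕ, u + x₁ + x₂ ≠ -(m : ℂ)) :
    ∃ S₁ S₂ : ℂ,
      Tendsto (fun N : ℕ => ∑ k ∈ Finset.range N,
          ((-1 : ℂ) ^ k / (k.factorial : ℂ))
          * (Complex.Gamma (lam - (lam - x₁) * (lam - x₂) / (lam + k))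
              * Complex.Gamma
                  (s - lam + (lam - x₁) * (lam - x₂) / (lam + k) + k)
            / (Complex.Gamma (t + k)
              * Complex.Gamma
                  (t - lam + (lam - x₁) * (lam - x₂) / (lam + k))
              * Complex.Gamma
                  (u + lam - (lam - x₁) * (lam - x₂) / (lam + k) - k)))
          * (1 / (x₁ + k) + 1 / (x₂ + k) - 1 / (lam + k)))
        atTop (𝓝 S₁)
      ∧ Tendsto (fun N : ℕ => ∑ k ∈ Finset.range N,
          ((-1 : ℂ) ^ k / (k.factorial : ℂ))
          * (Complex.Gamma (cp k) * Complex.Gamma (cm k)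
            / (Complex.Gamma (t - cp k) * Complex.Gamma (t - cm k)
              * Complex.Gamma (u + s + k)))
          * (1 / (s + k - x₁ - x₂)))
        atTop (𝓝 S₂)
      ∧ Complex.Gamma x₁ * Complex.Gamma x₂ * Complex.Gamma (s - x₁ - x₂)
          / (Complex.Gamma (t - x₁) * Complex.Gamma (t - x₂)
            * Complex.Gamma (u + x₁ + x₂))
        = S₁ + S₂ := by
  have hc' : ∀ k : ℕ, ∃ c : ℂ, ‖c - lam‖ ≤ ‖(s + k - c) - lam‖ ∧ ((c = cp k ∧ s + k - c = cm k) ∨ (c = cm k ∧ s + k - c = cp k)) := by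
    intro k
    have h1 := (hc k).1
    rcases le_total ‖cp k - lam‖ ‖cm k - lam‖ with h | h
    · have e : s + k - cp k = cm k := by rw [← h1]; ring
      exact ⟨cp k, by rw [e]; exact h, Or.inl ⟨rfl, e⟩⟩
    · have e : s + k - cm k = cp k := by rw [← h1]; ring
      exact ⟨cm k, by rw [e]; exact h, Or.inr ⟨rfl, e⟩⟩
  choose c hcn hcc using hc'
  have hcprod : ∀ k : ℕ, c k * (s + k - c k) = x₁ * x₂ + (s + k - x₁ - x₂) * lam := by
    intro k
    rcases hcc k with ⟨h1, h2⟩ | ⟨h1, h2⟩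
    · rw [h2, h1]; exact (hc k).2
    · rw [h2, h1, mul_comm]; exact (hc k).2
  have hc1 : ∀ k m : ℕ, c k ≠ -(m:ℂ) := by
    intro k m
    rcases hcc k with ⟨h1, h2⟩ | ⟨h1, h2⟩
    · rw [h1]; exact hcp k m
    · rw [h1]; exact hcm k m
  have hc2 : ∀ k m : ℕ, s - c k + k ≠ -(m:ℂ) := by
    intro k m
    have e : s - c k + k = s + k - c k := by ring
    rw [e]
    rcases hcc k with ⟨h1, h2⟩ | ⟨h1, h2⟩
    · rw [h2]; exact hcm k m
    · rw [h2]; exact hcp k m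
  obtain ⟨y, hy⟩ : ∃ y : ℕ → ℂ, ∀ k : ℕ, y k = lam - (lam - x₁) * (lam - x₂) / (lam + k) := ⟨_, fun _ => rfl⟩
  have hy1 : ∀ k m : ℕ, y k ≠ -(m:ℂ) := fun k m => by rw [hy k]; exact heps₁ k m
  have hy2 : ∀ k m : ℕ, s - y k + k ≠ -(m:ℂ) := fun k m => by
    have e : s - y k + k = s - lam + (lam - x₁) * (lam - x₂) / (lam + k) + k := by rw [hy k]; ring
    rw [e]; exact heps₂ k m
  -- the choice of the shifts
  obtain ⟨p, q, hp, hq, hq1, hq2⟩ : ∃ p q : ℕ, 1 ≤ p ∧ 1 ≤ q ∧ 0 ≤ (u + lam).re + q - p ∧ (u + lam).re + q - p < 1 := by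
    set M : ℤ := ⌈-(u + lam).re⌉ with hM
    have m1 := Int.le_ceil (-(u + lam).re)
    have m2 := Int.ceil_lt_add_one (-(u + lam).re)
    rw [← hM] at m1 m2
    refine ⟨(-M).toNat + 1, M.toNat + 1, by omega, by omega, ?_, ?_⟩
    · have : (((M.toNat + 1 : ℕ)):ℤ) = M + (((-M).toNat + 1 : ℕ):ℤ) := by omega
      have : (((M.toNat + 1 : ℕ)):ℝ) = M + (((-M).toNat + 1 : ℕ):ℝ) := by exact_mod_cast this
      linarith
    · have : (((M.toNat + 1 : ℕ)):ℤ) = M + (((-M).toNat + 1 : ℕ):ℤ) := by omega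
      have : (((M.toNat + 1 : ℕ)):ℝ) = M + (((-M).toNat + 1 : ℕ):ℝ) := by exact_mod_cast this
      linarith
  obtain ⟨C0, hC0, hd0⟩ := inv_decay lam hlam
  obtain ⟨C1, hC1, hd1⟩ := inv_decay x₁ hx₁
  obtain ⟨C2, hC2, hd2⟩ := inv_decay x₂ hx₂
  obtain ⟨C3, hC3, hd3⟩ := inv_decay (s - x₁ - x₂) hs'
  obtain ⟨τ, hτ⟩ : ∃ τ : ℂ, τ = s - 2 * t - u := ⟨_, rfl⟩
  obtain ⟨S₁, hS1, hT1⟩ := series_lim p p p q p q hp hp hp hq hp hq (by omega) τ t t u s lam y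
    (fun k => 1 / (x₁ + k) + 1 / (x₂ + k) - 1 / (lam + k)) (‖(lam - x₁) * (lam - x₂)‖ * C0) (C1 + C2 + C0)
    (by rw [hτ]; ring) (by convert hre using 2; ring) hlam (by positivity)
    (fun k => by
      have e : y k - lam = -(((lam - x₁) * (lam - x₂)) * (1 / (lam + k))) := by rw [hy k]; ring
      rw [e, norm_neg, norm_mul, mul_div_assoc]
      exact mul_le_mul_of_nonneg_left (hd0 k) (norm_nonneg _))
    hy1 hy2
    (fun k => by
      rw [add_div, add_div]
      exact (norm_sub_le _ _).trans (add_le_add ((norm_add_le _ _).trans (add_le_add (hd1 k) (hd2 k))) (hd0 k)))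
    (by linarith)
  obtain ⟨S₂, hS2, hT2⟩ := series_lim q q p p p p hq hq hp hp hp hp (by omega) τ (u + s) t (t - s) s lam c
    (fun k => 1 / (s + k - x₁ - x₂))
    (2 * ‖(lam - x₁) * (lam - x₂)‖ + (‖(lam - x₁) * (lam - x₂)‖ + 1) * (‖s - 2 * lam‖ + 1)) C3
    (by rw [hτ]; ring) (by convert hre using 2; ring) hlam (by positivity)
    (fun k => decay_c (c k - lam) (s + k - c k - lam) _ _ k (by linear_combination hcprod k) (by ring) (hcn k))
    hc1 hc2
    (fun k => by
      have e : s + (k:ℂ) - x₁ - x₂ = s - x₁ - x₂ + k := by ring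
      show ‖1 / (s + (k:ℂ) - x₁ - x₂)‖ ≤ _
      rw [e]; exact hd3 k)
    (by
      simp only [Complex.add_re, Complex.sub_re, Complex.mul_re, Complex.re_ofNat, Complex.im_ofNat, zero_mul, sub_zero] at hre hq2 ⊢
      linarith)
  refine ⟨S₁, S₂, ?_, ?_, ?_⟩
  · refine hS1.congr (fun N => Finset.sum_congr rfl (fun k _ => ?_))
    have e1 : s - y k + k = s - lam + (lam - x₁) * (lam - x₂) / (lam + k) + k := by rw [hy k]; ring
    have e2 : t - y k = t - lam + (lam - x₁) * (lam - x₂) / (lam + k) := by rw [hy k]; ring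
    have e3 : u + y k - k = u + lam - (lam - x₁) * (lam - x₂) / (lam + k) - k := by rw [hy k]; ring
    rw [e1, e2, e3, hy k]
  · refine hS2.congr (fun N => Finset.sum_congr rfl (fun k _ => ?_))
    have e1 : s - c k + k = s + k - c k := by ring
    have e3 : t - s + c k - k = t - (s + k - c k) := by ring
    rw [e1, e3]
    rcases hcc k with ⟨h1, h2⟩ | ⟨h1, h2⟩
    · rw [h2, h1]; ring
    · rw [h2, h1]; ring
  · have lim1 := lhs_lim p q hp hq τ (t - x₁) (t - x₂) (u + x₁ + x₂) x₁ x₂ (s - x₁ - x₂)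
      (by rw [hτ]; ring) hx₁ hx₂ hs'
    have lim0 := const_lim p q hp τ t lam (by
      have e : τ + t - 2 * lam = -(2 * lam - s + t + u) := by rw [hτ]; ring
      rw [e, Complex.neg_re]; linarith) hlam
    have lim2 := (lim0.add hT1).add hT2
    rw [zero_add] at lim2
    refine tendsto_nhds_unique lim1 (lim2.congr (fun n => ?_))
    rw [finite_id s t u lam x₁ x₂ y c n p q hy hcprod hx₁ hx₂ hlam hsx hy1 hy2,
      mul_add, mul_add, Finset.mul_sum, Finset.mul_sum]
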